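/- Let A be a computably enumerable set. Then A obeys every benign cost function if and only if A ≤_T Z for every Martin-Löf random ω-c.a. set Z. -/

import Mathlib

/-! Basic definitions: Cantor space, initial segments, computable approximations,
Martin-Löf randomness, change counting, cost functions, oracle computability. -/

/-- The length-`n` initial segment of `Z : ℕ → Bool`, as a list of booleans. -/
def restr (Z : ℕ → Bool) (n : ℕ) : List Bool := (List.range n).map Z

/-- `σ` is an initial segment of `Z`. -/
def InitSeg (σ : List Bool) (Z : ℕ → Bool) : Prop := σ = restr Z σ.length

/-- `Z` is Martin-Löf random: for every computable sequence of strings with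
finite total measure, only finitely many are initial segments of `Z`. -/
def MLRandom (Z : ℕ → Bool) : Prop :=
  ∀ σ : ℕ → List Bool, Computable σ →
    Summable (fun i => ((1 : ℝ) / 2) ^ (σ i).length) →
    {i | InitSeg (σ i) Z}.Finite

/-- `(Zs s) s∈ℕ` converges pointwise to `Z`. -/
def Approx (Zs : ℕ → ℕ → Bool) (Z : ℕ → Bool) : Prop :=
  ∀ x, ∃ t, ∀ s, t ≤ s → Zs s x = Z x

/-- `Zs` is a computable approximation of `Z`. -/
def CompApprox (Zs : ℕ → ℕ → Bool) (Z : ℕ → Bool) : Prop :=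
  Computable₂ Zs ∧ Approx Zs Z

/-- `Z` is Δ⁰₂: it has a computable approximation. -/
def Delta02 (Z : ℕ → Bool) : Prop := ∃ Zs, CompApprox Zs Z

/-- The set of stages `s ≥ 1` at which the length-`n` initial segment of the
approximation changes. -/
def changeStages (Zs : ℕ → ℕ → Bool) (n : ℕ) : Set ℕ :=
  {s | 1 ≤ s ∧ restr (Zs s) n ≠ restr (Zs (s - 1)) n}

/-- `Z` is a `g`-change set. -/
def GChangeSet (Z : ℕ → Bool) (g : ℕ → ℕ) : Prop :=
  ∃ Zs, CompApprox Zs Z ∧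
    ∀ n, (changeStages Zs n).Finite ∧ (changeStages Zs n).ncard ≤ g n

/-- `Z` is ω-c.a.: a `g`-change set for some computable `g`. -/
def OmegaCA (Z : ℕ → Bool) : Prop := ∃ g : ℕ → ℕ, Computable g ∧ GChangeSet Z g

/-- Lexicographic order on Cantor space. -/
def LexLE (X Y : ℕ → Bool) : Prop :=
  X = Y ∨ ∃ n, (∀ i, i < n → X i = Y i) ∧ X n = false ∧ Y n = true

/-- `Z` is left-c.e. -/
def LeftCE (Z : ℕ → Bool) : Prop :=
  ∃ Zs, CompApprox Zs Z ∧ ∀ s, LexLE (Zs s) (Zs (s + 1))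

/-- `c` is a cost function: computable, nonnegative, nondecreasing in the stage,
nonincreasing in the number. -/
def CostFunction (c : ℕ → ℕ → ℚ) : Prop :=
  Computable₂ c ∧ (∀ x s, 0 ≤ c x s) ∧
    (∀ x s t, s ≤ t → c x s ≤ c x t) ∧ (∀ x y s, x ≤ y → c y s ≤ c x s)

/-- The limit condition for a cost function. -/
def LimitCondition (c : ℕ → ℕ → ℚ) : Prop :=
  ∀ ε : ℚ, 0 < ε → ∃ x₀, ∀ x, x₀ ≤ x → ∀ s, c x s ≤ ε

/-- A benign cost function: the number of pairwise disjoint intervals `[x,s)` with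
`c x s ≥ 2^{-k}` is computably bounded in `k`. -/
def Benign (c : ℕ → ℕ → ℚ) : Prop :=
  ∃ b : ℕ → ℕ, Computable b ∧
    ∀ k m (x s : ℕ → ℕ), (∀ i, i < m → x i < s i) →
      (∀ i, i + 1 < m → s i ≤ x (i + 1)) →
      (∀ i, i < m → ((1 : ℚ) / 2) ^ k ≤ c (x i) (s i)) → m ≤ b k

open Classical in
/-- The cost paid at stage `s` by the approximation `As`: if `s ≥ 1` and the
approximation changes at `s`, it is `c x s` where `x` is the least changed number. -/
noncomputable def stageCost (c : ℕ → ℕ → ℚ) (As : ℕ → ℕ → Bool) (s : ℕ) : ℚ :=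
  if s = 0 then 0
  else if h : ∃ x, As s x ≠ As (s - 1) x then c (Nat.find h) s else 0

/-- `A` obeys the cost function `c`: some computable approximation of `A` has
finite total cost. -/
def Obeys (A : ℕ → Bool) (c : ℕ → ℕ → ℚ) : Prop :=
  ∃ As, CompApprox As A ∧ ∃ B : ℚ, ∀ F : Finset ℕ, ∑ s ∈ F, stageCost c As s ≤ B

/-- Functions partial recursive in the oracle `O`. -/
inductive RecIn (O : ℕ →. ℕ) : (ℕ →. ℕ) → Prop
  | oracle : RecIn O O
  | zero : RecIn O (pure 0)
  | succ : RecIn O ↑Nat.succ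
  | left : RecIn O ↑fun n : ℕ => n.unpair.1
  | right : RecIn O ↑fun n : ℕ => n.unpair.2
  | pair {f g} : RecIn O f → RecIn O g → RecIn O fun n => Nat.pair <$> f n <*> g n
  | comp {f g} : RecIn O f → RecIn O g → RecIn O fun n => g n >>= f
  | prec {f g} : RecIn O f → RecIn O g → RecIn O (Nat.unpaired fun a n =>
      n.rec (f a) fun y IH => do let i ← IH; g (Nat.pair a (Nat.pair y i)))
  | rfind {f} : RecIn O f → RecIn O fun a =>
      Nat.rfind fun n => (fun m => m = 0) <$> f (Nat.pair a n)

/-- The characteristic function of `A` as a partial function ℕ →. ℕ. -/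
def charFn (A : ℕ → Bool) : ℕ →. ℕ := fun n => Part.some (cond (A n) 1 0)

/-- Turing reducibility: `A ≤_T Z`. -/
def TuringLE (A Z : ℕ → Bool) : Prop := RecIn (charFn Z) (charFn A)

/-- `A` is computably enumerable: the domain of a partial computable function. -/
def CE (A : ℕ → Bool) : Prop :=
  ∃ f : ℕ →. ℕ, Nat.Partrec f ∧ ∀ x, A x = true ↔ (f x).Dom

/-- A Π⁰₁ class of elements of Cantor space. -/
def Pi01 (P : Set (ℕ → Bool)) : Prop :=
  ∃ f : ℕ → Option (List Bool), Computable f ∧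
    P = {Z | ∀ i σ, f i = some σ → ¬ InitSeg σ Z}

/-- The c.e. set `W_e`: the domain of the `e`-th partial computable function. -/
def Wset (e : ℕ) : Set ℕ :=
  {x | ((Denumerable.ofNat Nat.Partrec.Code e).eval x).Dom}

/-- The stage-`s` approximation to `W_e`, via step-bounded evaluation. -/
def WAt (e s x : ℕ) : Prop :=
  (Nat.Partrec.Code.evaln s (Denumerable.ofNat Nat.Partrec.Code e) x).isSome

/-- `A` is promptly simple. -/
def PromptlySimple (A : ℕ → Bool) : Prop :=
  CE A ∧ {x | A x = false}.Infinite ∧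
    ∃ As : ℕ → ℕ → Bool, Computable₂ As ∧
      (∀ s x, As s x = true → As (s + 1) x = true) ∧
      (∀ x, A x = true ↔ ∃ s, As s x = true) ∧
      ∀ e, (Wset e).Infinite →
        ∃ s x, 1 ≤ s ∧ WAt e s x ∧ ¬ WAt e (s - 1) x ∧ As s x = true

/-! ## Computability toolkit -/

attribute [fun_prop] Computable
attribute [fun_prop] Computable.id Computable.const Computable.comp

section Toolkit

variable {α β γ : Type} [Primcodable α] [Primcodable β] [Primcodable γ]

@[fun_prop] theorem c_id : Computable (fun a : α => a) := Computable.id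

@[fun_prop] theorem c_fst {f : α → β × γ} (h : Computable f) :
    Computable (fun a => (f a).1) := Computable.fst.comp h

@[fun_prop] theorem c_snd {f : α → β × γ} (h : Computable f) :
    Computable (fun a => (f a).2) := Computable.snd.comp h

@[fun_prop] theorem c_pair {f : α → β} {g : α → γ} (h : Computable f) (h2 : Computable g) :
    Computable (fun a => (f a, g a)) := h.pair h2

@[fun_prop] theorem c_add {f g : α → ℕ} (h : Computable f) (h2 : Computable g) :
    Computable (fun a => f a + g a) := Primrec.nat_add.to_comp.comp h h2

@[fun_prop] theorem c_sub {f g : α → ℕ} (h : Computable f) (h2 : Computable g) :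
    Computable (fun a => f a - g a) := Primrec.nat_sub.to_comp.comp h h2

@[fun_prop] theorem c_mul {f g : α → ℕ} (h : Computable f) (h2 : Computable g) :
    Computable (fun a => f a * g a) := Primrec.nat_mul.to_comp.comp h h2

@[fun_prop] theorem c_div {f g : α → ℕ} (h : Computable f) (h2 : Computable g) :
    Computable (fun a => f a / g a) := Primrec.nat_div.to_comp.comp h h2

@[fun_prop] theorem c_mod {f g : α → ℕ} (h : Computable f) (h2 : Computable g) :
    Computable (fun a => f a % g a) := Primrec.nat_mod.to_comp.comp h h2

@[fun_prop] theorem c_max {f g : α → ℕ} (h : Computable f) (h2 : Computable g) :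
    Computable (fun a => max (f a) (g a)) := Primrec.nat_max.to_comp.comp h h2

@[fun_prop] theorem c_npair {f g : α → ℕ} (h : Computable f) (h2 : Computable g) :
    Computable (fun a => Nat.pair (f a) (g a)) := Primrec₂.natPair.to_comp.comp h h2

@[fun_prop] theorem c_unpair {f : α → ℕ} (h : Computable f) :
    Computable (fun a => Nat.unpair (f a)) := Computable.unpair.comp h

theorem prim_pow : Primrec₂ (fun a b : ℕ => a ^ b) :=
  Primrec₂.unpaired'.1 Nat.Primrec.pow

@[fun_prop] theorem c_pow {f g : α → ℕ} (h : Computable f) (h2 : Computable g) :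
    Computable (fun a => f a ^ g a) := prim_pow.to_comp.comp h h2

@[fun_prop] theorem c_and {f g : α → Bool} (h : Computable f) (h2 : Computable g) :
    Computable (fun a => f a && g a) := Primrec.and.to_comp.comp h h2

@[fun_prop] theorem c_or {f g : α → Bool} (h : Computable f) (h2 : Computable g) :
    Computable (fun a => f a || g a) := Primrec.or.to_comp.comp h h2

@[fun_prop] theorem c_not {f : α → Bool} (h : Computable f) :
    Computable (fun a => !(f a)) := Primrec.not.to_comp.comp h

@[fun_prop] theorem c_cond {c : α → Bool} {f g : α → β} (hc : Computable c) (h : Computable f)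
    (h2 : Computable g) : Computable (fun a => bif c a then f a else g a) := Computable.cond hc h h2

@[fun_prop] theorem c_ite {c : α → Bool} {f g : α → β} (hc : Computable c) (h : Computable f)
    (h2 : Computable g) : Computable (fun a => if c a = true then f a else g a) :=
  (Computable.cond hc h h2).of_eq (fun a => by cases c a <;> simp)

theorem c_le {f g : α → ℕ} (h : Computable f) (h2 : Computable g) :
    Computable (fun a => decide (f a ≤ g a)) :=
  (PrimrecRel.decide Primrec.nat_le).to_comp.comp h h2

theorem c_lt {f g : α → ℕ} (h : Computable f) (h2 : Computable g) :
    Computable (fun a => decide (f a < g a)) :=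
  (PrimrecRel.decide Primrec.nat_lt).to_comp.comp h h2

theorem c_eq [DecidableEq β] {f g : α → β} (h : Computable f) (h2 : Computable g) :
    Computable (fun a => decide (f a = g a)) :=
  (PrimrecRel.decide Primrec.eq).to_comp.comp h h2

/-- Boolean comparison -/
def leb (a b : ℕ) : Bool := decide (a ≤ b)

/-- Boolean strict comparison -/
def ltb (a b : ℕ) : Bool := decide (a < b)

/-- Boolean equality of numbers -/
def eqb (a b : ℕ) : Bool := decide (a = b)

/-- Boolean equality of Booleans -/
def beqb (a b : Bool) : Bool := decide (a = b)

@[simp] theorem leb_iff {a b : ℕ} : leb a b = true ↔ a ≤ b := by simp [leb]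
@[simp] theorem ltb_iff {a b : ℕ} : ltb a b = true ↔ a < b := by simp [ltb]
@[simp] theorem eqb_iff {a b : ℕ} : eqb a b = true ↔ a = b := by simp [eqb]
@[simp] theorem beqb_iff {a b : Bool} : beqb a b = true ↔ a = b := by simp [beqb]
@[simp] theorem leb_iff' {a b : ℕ} : leb a b = false ↔ ¬ a ≤ b := by simp [leb]
@[simp] theorem ltb_iff' {a b : ℕ} : ltb a b = false ↔ ¬ a < b := by simp [ltb]
@[simp] theorem eqb_iff' {a b : ℕ} : eqb a b = false ↔ ¬ a = b := by simp [eqb]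
@[simp] theorem beqb_iff' {a b : Bool} : beqb a b = false ↔ ¬ a = b := by simp [beqb]

@[fun_prop] theorem c_leb {f g : α → ℕ} (h : Computable f) (h2 : Computable g) :
    Computable (fun a => leb (f a) (g a)) := c_le h h2

@[fun_prop] theorem c_ltb {f g : α → ℕ} (h : Computable f) (h2 : Computable g) :
    Computable (fun a => ltb (f a) (g a)) := c_lt h h2

@[fun_prop] theorem c_eqb {f g : α → ℕ} (h : Computable f) (h2 : Computable g) :
    Computable (fun a => eqb (f a) (g a)) := c_eq h h2

@[fun_prop] theorem c_beqb {f g : α → Bool} (h : Computable f) (h2 : Computable g) :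
    Computable (fun a => beqb (f a) (g a)) := c_eq h h2

@[fun_prop] theorem c_some {f : α → β} (h : Computable f) :
    Computable (fun a => some (f a)) := Computable.option_some.comp h

@[fun_prop] theorem c_toNat {f : α → Bool} (h : Computable f) :
    Computable (fun a => (f a).toNat) :=
  (Computable.cond h (Computable.const 1) (Computable.const 0)).of_eq
    (fun a => by cases f a <;> simp)

@[fun_prop] theorem c_rec {n : α → ℕ} {z : α → β} {f : α → ℕ → β → β} (hn : Computable n)
    (hz : Computable z) (hf : Computable fun p : α × ℕ × β => f p.1 p.2.1 p.2.2) :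
    Computable (fun a => Nat.rec (motive := fun _ => β) (z a) (fun i r => f a i r) (n a)) :=
  Computable.nat_rec hn hz (h := fun a p => f a p.1 p.2) hf

/-- bounded universal quantification -/
def ball (n : ℕ) (f : ℕ → Bool) : Bool :=
  Nat.rec (motive := fun _ => Bool) true (fun i r => r && f i) n

theorem ball_iff {n : ℕ} {f : ℕ → Bool} : ball n f = true ↔ ∀ i < n, f i = true := by
  induction n with
  | zero => simp [ball]
  | succ n ih =>
    have : ball (n+1) f = (ball n f && f n) := rfl
    rw [this, Bool.and_eq_true, ih]
    constructor
    · rintro ⟨h1, h2⟩ i hi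
      rcases Nat.lt_succ_iff_lt_or_eq.1 hi with h | rfl
      · exact h1 i h
      · exact h2
    · intro h
      exact ⟨fun i hi => h i (by omega), h n (by omega)⟩

/-- bounded existential quantification -/
def bex (n : ℕ) (f : ℕ → Bool) : Bool :=
  !(ball n fun i => !(f i))

theorem bex_iff {n : ℕ} {f : ℕ → Bool} : bex n f = true ↔ ∃ i < n, f i = true := by
  have h := ball_iff (n := n) (f := fun i => !(f i))
  unfold bex
  rw [Bool.not_eq_true', ← Bool.not_eq_true, h]
  simp

@[fun_prop] theorem c_ball {n : α → ℕ} {f : α → ℕ → Bool} (hn : Computable n)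
    (hf : Computable fun p : α × ℕ => f p.1 p.2) :
    Computable (fun a => ball (n a) (fun i => f a i)) := by
  unfold ball
  fun_prop

@[fun_prop] theorem c_bex {n : α → ℕ} {f : α → ℕ → Bool} (hn : Computable n)
    (hf : Computable fun p : α × ℕ => f p.1 p.2) :
    Computable (fun a => bex (n a) (fun i => f a i)) := by
  unfold bex
  fun_prop

@[fun_prop] theorem c_sum {n : α → ℕ} {f : α → ℕ → ℕ} (hn : Computable n)
    (hf : Computable fun p : α × ℕ => f p.1 p.2) :
    Computable (fun a => ∑ i ∈ Finset.range (n a), f a i) := by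
  have : Computable (fun a => Nat.rec (motive := fun _ => ℕ) 0 (fun i r => r + f a i) (n a)) := by
    fun_prop
  refine this.of_eq (fun a => ?_)
  induction n a with
  | zero => rfl
  | succ k ih => rw [Finset.sum_range_succ, ← ih]

theorem c_find {p : α → ℕ → Bool} (hp : Computable fun q : α × ℕ => p q.1 q.2)
    (h : ∀ a, ∃ n, p a n = true) : Computable (fun a => Nat.find (h a)) := by
  have : Partrec fun a => Nat.rfind (fun n => Part.some (p a n)) :=
    Partrec.rfind (p := fun a n => Part.some (p a n)) (Computable.partrec hp)
  refine this.of_eq_tot (fun a => ?_)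
  refine Nat.mem_rfind.2 ⟨by simpa using (Nat.find_spec (h a)), fun {m} hm => ?_⟩
  have := Nat.find_min (h a) hm
  simpa using this

end Toolkit

/-! ## Rationals -/

section RatComp

/-- code of a rational under the structural encoding -/
def oc (q : ℚ) : ℕ := @Encodable.encode ℚ Rat.instEncodable q

theorem oc_eq (q : ℚ) : oc q = Nat.pair (@Encodable.encode ℤ Int.encodable q.num) q.den := rfl

theorem natAbs_code (z : ℤ) : (@Encodable.encode ℤ Int.encodable z + 1) / 2 = z.natAbs := by
  cases z with
  | ofNat n =>
    have : @Encodable.encode ℤ Int.encodable (Int.ofNat n) = 2 * n := rfl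
    rw [this]; simp; omega
  | negSucc n =>
    have : @Encodable.encode ℤ Int.encodable (Int.negSucc n) = 2 * n + 1 := rfl
    rw [this]; simp; omega

theorem sign_code (z : ℤ) : (@Encodable.encode ℤ Int.encodable z) % 2 = 0 ↔ 0 ≤ z := by
  cases z with
  | ofNat n =>
    have : @Encodable.encode ℤ Int.encodable (Int.ofNat n) = 2 * n := rfl
    rw [this]; simp
  | negSucc n =>
    have : @Encodable.encode ℤ Int.encodable (Int.negSucc n) = 2 * n + 1 := rfl
    rw [this]
    have := Int.negSucc_lt_zero n
    omega

theorem int_code_surj (k : ℕ) : ∃ z : ℤ, @Encodable.encode ℤ Int.encodable z = k :=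
  Equiv.intEquivNat.surjective k

/-- which numbers are codes of rationals -/
def isOc (k : ℕ) : Bool :=
  ltb 0 k.unpair.2 &&
    ball (k.unpair.2 + 1) fun d => ltb d 2 ||
      !(eqb (k.unpair.2 % d) 0 && eqb (((k.unpair.1 + 1) / 2) % d) 0)

theorem isOc_iff (k : ℕ) : isOc k = true ↔ k ∈ Set.range oc := by
  have key : isOc k = true ↔ 0 < k.unpair.2 ∧ ((k.unpair.1 + 1) / 2).Coprime k.unpair.2 := by
    unfold isOc
    rw [Bool.and_eq_true, ball_iff]
    simp only [ltb_iff, Bool.or_eq_true, Bool.not_eq_true', Bool.and_eq_false_iff,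
      eqb_iff']
    refine and_congr_right fun hpos => ?_
    constructor
    · intro h
      by_contra hc
      have h2 := h (((k.unpair.1 + 1) / 2).gcd k.unpair.2)
        (Nat.lt_succ_of_le (Nat.gcd_le_right _ hpos))
      have h3 : ((k.unpair.1 + 1) / 2).gcd k.unpair.2 ≠ 1 := hc
      have h4 : 0 < ((k.unpair.1 + 1) / 2).gcd k.unpair.2 := Nat.gcd_pos_of_pos_right _ hpos
      rcases h2 with h2 | h2 | h2
      · omega
      · exact h2 (Nat.mod_eq_zero_of_dvd (Nat.gcd_dvd_right _ _))
      · exact h2 (Nat.mod_eq_zero_of_dvd (Nat.gcd_dvd_left _ _))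
    · intro h d hd
      by_contra hc
      push Not at hc
      obtain ⟨h1, h2, h3⟩ := hc
      have := Nat.dvd_gcd (Nat.dvd_of_mod_eq_zero h3) (Nat.dvd_of_mod_eq_zero h2)
      rw [h] at this
      have := Nat.le_of_dvd one_pos this
      omega
  rw [key]
  constructor
  · rintro ⟨h1, h2⟩
    obtain ⟨z, hz⟩ := int_code_surj k.unpair.1
    rw [← hz, natAbs_code] at h2
    refine ⟨⟨z, k.unpair.2, h1.ne', h2⟩, ?_⟩
    rw [oc_eq]
    simp only [hz]
    exact Nat.pair_unpair k
  · rintro ⟨q, rfl⟩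
    rw [oc_eq, Nat.unpair_pair]
    simp only [natAbs_code]
    exact ⟨q.den_pos, q.reduced⟩

theorem c_isOc : Computable isOc := by
  unfold isOc
  fun_prop

theorem oc_injective : Function.Injective oc := Encodable.encode_injective

instance oc_range_infinite : Infinite (Set.range oc) :=
  Infinite.of_injective _ (Equiv.ofInjective _ oc_injective).injective

theorem exists_next (x : ℕ) : ∃ m, isOc (x + m + 1) = true := by
  have h := (Set.infinite_coe_iff.1 oc_range_infinite).exists_gt x
  obtain ⟨b, hb, hx⟩ := h
  refine ⟨b - x - 1, ?_⟩
  rw [isOc_iff]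
  convert hb using 1
  omega

/-- distance to the next code -/
def nextOc (x : ℕ) : ℕ := Nat.find (exists_next x)

theorem c_nextOc : Computable nextOc :=
    c_find (p := fun x m => isOc (x + m + 1)) (by
      have := c_isOc
      fun_prop) exists_next

/-- decidability of the range of `oc`, as used in Mathlib's instance -/
@[reducible]
def ocDec : DecidablePred (· ∈ Set.range oc) := @Encodable.decidableRangeEncode ℚ Rat.instEncodable

theorem oc_ofNat (n : ℕ) : oc (Denumerable.ofNat ℚ n) =
    (@Nat.Subtype.ofNat (Set.range oc) ocDec oc_range_infinite n : ℕ) := by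
  have h : Denumerable.ofNat ℚ n = (@Encodable.equivRangeEncode ℚ Rat.instEncodable).symm
      (@Nat.Subtype.ofNat (Set.range oc) ocDec oc_range_infinite n) := rfl
  rw [h]
  have h2 := (@Encodable.equivRangeEncode ℚ Rat.instEncodable).apply_symm_apply
    (@Nat.Subtype.ofNat (Set.range oc) ocDec oc_range_infinite n)
  exact congrArg Subtype.val h2

theorem oc_ofNat_succ (n : ℕ) : oc (Denumerable.ofNat ℚ (n+1)) =
    oc (Denumerable.ofNat ℚ n) + nextOc (oc (Denumerable.ofNat ℚ n)) + 1 := by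
  rw [oc_ofNat (n+1), oc_ofNat n]
  have : (@Nat.Subtype.ofNat (Set.range oc) ocDec oc_range_infinite (n+1)) =
    @Nat.Subtype.succ (Set.range oc) oc_range_infinite ocDec
      (@Nat.Subtype.ofNat (Set.range oc) ocDec oc_range_infinite n) := rfl
  rw [this]
  unfold Nat.Subtype.succ nextOc
  simp only [Nat.add_right_cancel_iff, Nat.add_left_cancel_iff]
  congr 1
  funext m
  exact propext (isOc_iff _).symm

theorem c_oc_ofNat : Computable (fun n => oc (Denumerable.ofNat ℚ n)) := by
  have hf := c_nextOc
  have : Computable (fun n => Nat.rec (motive := fun _ => ℕ) (oc (Denumerable.ofNat ℚ 0))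
      (fun _ r => r + nextOc r + 1) n) := by
    fun_prop
  refine this.of_eq (fun n => ?_)
  induction n with
  | zero => rfl
  | succ n ih => rw [oc_ofNat_succ, ← ih]

theorem c_oc : Computable oc := by
  have := c_oc_ofNat.comp (Computable.encode (α := ℚ))
  refine this.of_eq (fun q => ?_)
  exact congrArg oc (Denumerable.ofNat_encode q)

/-- a local name for `Denumerable.ofNat ℚ`, to keep terms small -/
def ratOf (n : ℕ) : ℚ := Denumerable.ofNat ℚ n

theorem ratOf_surj (q : ℚ) : ∃ n, ratOf n = q :=
  ⟨@Encodable.encode ℚ Denumerable.toEncodable q, Denumerable.ofNat_encode q⟩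

theorem c_ratOf : Computable ratOf := Computable.ofNat ℚ

@[fun_prop] theorem c_den {α : Type} [Primcodable α] {f : α → ℚ} (hf : Computable f) :
    Computable (fun a => (f a).den) := by
  have h : Computable (fun a => (oc (f a)).unpair.2) := by
    have := c_oc
    fun_prop
  exact h.of_eq (fun a => by rw [oc_eq, Nat.unpair_pair])

@[fun_prop] theorem c_numAbs {α : Type} [Primcodable α] {f : α → ℚ} (hf : Computable f) :
    Computable (fun a => (f a).num.natAbs) := by
  have h : Computable (fun a => ((oc (f a)).unpair.1 + 1) / 2) := by
    have := c_oc
    fun_prop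
  exact h.of_eq (fun a => by rw [oc_eq, Nat.unpair_pair, natAbs_code])

theorem c_nonneg {α : Type} [Primcodable α] {f : α → ℚ} (hf : Computable f) :
    Computable (fun a => decide (0 ≤ f a)) := by
  have h : Computable (fun a => eqb (((oc (f a)).unpair.1) % 2) 0) := by
    have := c_oc
    fun_prop
  unfold eqb at h
  refine h.of_eq (fun a => ?_)
  rw [oc_eq, Nat.unpair_pair, decide_eq_decide]
  simp only [sign_code, Rat.num_nonneg]

theorem rat_eq_frac {q : ℚ} (hq : 0 ≤ q) : q = (q.num.natAbs : ℚ) / q.den := by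
  have h1 : ((q.num.natAbs : ℤ) : ℚ) = (q.num : ℚ) := by
    rw [Int.natAbs_of_nonneg (Rat.num_nonneg.2 hq)]
  have h2 : (q.num.natAbs : ℚ) = (q.num : ℚ) := by
    rw [← h1]; simp
  rw [h2, Rat.num_div_den]

theorem frac_spec {q : ℚ} (hq : 0 ≤ q) (N D : ℕ) (hD : 0 < D) :
    q.num.natAbs * D = N * q.den ↔ q = (N : ℚ) / D := by
  have hd : (0 : ℚ) < q.den := by exact_mod_cast q.den_pos
  have hD' : (0 : ℚ) < D := by exact_mod_cast hD
  conv_rhs => rw [rat_eq_frac hq, div_eq_div_iff hd.ne' hD'.ne']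
  norm_cast

theorem c_frac {α : Type} [Primcodable α] {N D : α → ℕ} (hN : Computable N) (hD : Computable D)
    (hpos : ∀ a, 0 < D a) : Computable (fun a => (N a : ℚ) / (D a : ℚ)) := by
  have hex : ∀ a, ∃ n, (decide (0 ≤ ratOf n) &&
      decide ((ratOf n).num.natAbs * D a = N a * (ratOf n).den))
        = true := by
    intro a
    obtain ⟨n, hn⟩ := ratOf_surj ((N a : ℚ) / (D a : ℚ))
    refine ⟨n, ?_⟩
    rw [hn]
    have h0 : 0 ≤ (N a : ℚ) / (D a : ℚ) := by positivity
    simp only [h0, (frac_spec h0 _ _ (hpos a)).2 rfl, decide_true, Bool.and_self]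
  have h1 := c_ratOf
  have := c_find (p := fun a n => (decide (0 ≤ ratOf n) &&
      decide ((ratOf n).num.natAbs * D a = N a * (ratOf n).den)))
      (c_and (c_nonneg (by fun_prop)) (c_eq (by fun_prop) (by fun_prop))) hex
  refine (h1.comp this).of_eq (fun a => ?_)
  have hs := Nat.find_spec (hex a)
  rw [Bool.and_eq_true, decide_eq_true_eq, decide_eq_true_eq] at hs
  exact (frac_spec hs.1 _ _ (hpos a)).1 hs.2

/-- comparison of a nonnegative rational with a fraction -/
theorem frac_lt_iff {q : ℚ} (hq : 0 ≤ q) (k : ℕ) :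
    (1/2 : ℚ)^k < q ↔ q.den < q.num.natAbs * 2^k := by
  have hd : (0 : ℚ) < q.den := by exact_mod_cast q.den_pos
  conv_lhs => rw [rat_eq_frac hq, lt_div_iff₀ hd, one_div, inv_pow,
    inv_mul_lt_iff₀ (by positivity : (0:ℚ) < 2^k), mul_comm]
  norm_cast

end RatComp


/-! ## Strings as numbers, counting -/

/-- the length-`n` initial segment of `Y` read as a binary number -/
def pre (Y : ℕ → Bool) (n : ℕ) : ℕ :=
  Nat.rec (motive := fun _ => ℕ) 0 (fun i r => 2 * r + (Y i).toNat) n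

theorem pre_zero (Y : ℕ → Bool) : pre Y 0 = 0 := rfl

theorem pre_succ (Y : ℕ → Bool) (n : ℕ) : pre Y (n+1) = 2 * pre Y n + (Y n).toNat := rfl

theorem pre_lt (Y : ℕ → Bool) (n : ℕ) : pre Y n < 2 ^ n := by
  induction n with
  | zero => simp [pre_zero]
  | succ n ih =>
    have := Bool.toNat_le (Y n)
    rw [pre_succ, pow_succ]
    omega

theorem pre_eq_iff (Y Y' : ℕ → Bool) (n : ℕ) : pre Y n = pre Y' n ↔ ∀ i < n, Y i = Y' i := by
  induction n with
  | zero => simp [pre_zero]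
  | succ n ih =>
    have h1 := Bool.toNat_le (Y n)
    have h2 := Bool.toNat_le (Y' n)
    rw [pre_succ, pre_succ]
    constructor
    · intro h
      have h3 : pre Y n = pre Y' n := by omega
      have h4 : (Y n).toNat = (Y' n).toNat := by omega
      intro i hi
      rcases Nat.lt_succ_iff_lt_or_eq.1 hi with h | rfl
      · exact ih.1 h3 i h
      · revert h4; cases Y i <;> cases Y' i <;> simp
    · intro h
      rw [ih.2 (fun i hi => h i (by omega)), h n (by omega)]

theorem pre_div (Y : ℕ → Bool) (n k : ℕ) : pre Y (n + k) / 2 ^ k = pre Y n := by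
  induction k with
  | zero => simp
  | succ k ih =>
    have h1 := Bool.toNat_le (Y (n+k))
    rw [← add_assoc, pre_succ, pow_succ, mul_comm (2^k) 2, ← Nat.div_div_eq_div_mul]
    rw [show (2 * pre Y (n + k) + (Y (n + k)).toNat) / 2 = pre Y (n+k) by omega, ih]

theorem pre_div' (Y : ℕ → Bool) {n s : ℕ} (h : n ≤ s) : pre Y s / 2 ^ (s - n) = pre Y n := by
  obtain ⟨k, rfl⟩ := Nat.exists_eq_add_of_le h
  rw [Nat.add_sub_cancel_left, pre_div]

theorem restr_eq_iff (Y Y' : ℕ → Bool) (n : ℕ) :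
    restr Y n = restr Y' n ↔ pre Y n = pre Y' n := by
  rw [pre_eq_iff]
  unfold restr
  rw [List.map_inj_left]
  simp

/-- A set all of whose bounded pieces have at most `g` elements. -/
theorem ncard_of_count (P : ℕ → Prop) [DecidablePred P] (g : ℕ)
    (h : ∀ S, ((Finset.range S).filter P).card ≤ g) :
    {s | P s}.Finite ∧ {s | P s}.ncard ≤ g := by
  have key : ∀ t : Finset ℕ, (t : Set ℕ) ⊆ {s | P s} → t.card ≤ g := by
    intro t ht
    refine le_trans (Finset.card_le_card ?_) (h (t.sup id + 1))
    intro x hx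
    rw [Finset.mem_filter, Finset.mem_range]
    exact ⟨Nat.lt_succ_of_le (Finset.le_sup (f := id) hx), ht hx⟩
  have hfin : {s | P s}.Finite := by
    by_contra hinf
    obtain ⟨t, ht, hc⟩ := Set.Infinite.exists_subset_card_eq hinf (g+1)
    have := key t ht
    omega
  refine ⟨hfin, ?_⟩
  rw [Set.ncard_eq_toFinset_card _ hfin]
  exact key _ (by simp)

theorem count_succ (P : ℕ → Prop) [DecidablePred P] (S : ℕ) :
    ((Finset.range (S+1)).filter P).card =
      ((Finset.range S).filter P).card + if P S then 1 else 0 := by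
  rw [Finset.range_add_one, Finset.filter_insert]
  split_ifs with h
  · rw [Finset.card_insert_of_notMem (by simp)]
  · rfl

theorem sum_half (g : ℕ → ℕ) (k : ℕ) :
    ∑ w ∈ Finset.range (2 * k), g (w / 2) = 2 * ∑ w ∈ Finset.range k, g w := by
  induction k with
  | zero => simp
  | succ k ih =>
    rw [show 2 * (k+1) = 2*k + 1 + 1 by ring, Finset.sum_range_succ, Finset.sum_range_succ, ih,
      Finset.sum_range_succ, show (2*k+1)/2 = k by omega, show 2*k/2 = k by omega]
    ring

/-! ## The avoidance lemma -/

section Avoid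

variable (W : ℕ → ℕ → ℕ → ℕ)

/-- total weight of requirement `m` at stage `s` above the node `u` of length `n` -/
def mass (m s n u : ℕ) : ℕ := ∑ w ∈ Finset.range (2 ^ (s - n)), W m s (u * 2 ^ (s - n) + w)

/-- the node `u` of length `n` is still acceptable at stage `s` -/
def okNode (n s u : ℕ) : Bool :=
  decide ((∑ m ∈ Finset.range (2 * n + 1), mass W m s n u * 2 ^ (4 * n - 2 * m)) * 2 ^ (2 * n + 2)
    ≤ (3 * 2 ^ n - 2) * 2 ^ s * 2 ^ (4 * n + 3))

/-- the leftmost acceptable node of length `n` at stage `s` -/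
def tau (s n : ℕ) : ℕ :=
  Nat.rec (motive := fun _ => ℕ) 0
    (fun i r => bif okNode W (i+1) s (2 * r) then 2 * r else 2 * r + 1) n

theorem tau_zero (s : ℕ) : tau W s 0 = 0 := rfl

theorem tau_succ (s n : ℕ) : tau W s (n+1) =
    bif okNode W (n+1) s (2 * tau W s n) then 2 * tau W s n else 2 * tau W s n + 1 := rfl

/-- requirement `m` is reset at stage `s` -/
def Resets (m s : ℕ) : Prop := ¬ ∀ v < 2 ^ (s+1), W m s (v / 2) ≤ W m (s+1) v

theorem c_mass (hW : Computable fun p : ℕ × ℕ × ℕ => W p.1 p.2.1 p.2.2) :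
    Computable fun p : ℕ × ℕ × ℕ × ℕ => mass W p.1 p.2.1 p.2.2.1 p.2.2.2 := by
  unfold mass
  fun_prop

theorem c_okNode (hW : Computable fun p : ℕ × ℕ × ℕ => W p.1 p.2.1 p.2.2) :
    Computable fun p : ℕ × ℕ × ℕ => okNode W p.1 p.2.1 p.2.2 := by
  have h := c_mass W hW
  unfold okNode
  generalize mass W = M at *
  have h1 : Computable fun p : ℕ × ℕ × ℕ =>
      ∑ m ∈ Finset.range (2 * p.1 + 1), M m p.2.1 p.1 p.2.2 * 2 ^ (4 * p.1 - 2 * m) := by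
    fun_prop
  have h2 : Computable fun p : ℕ × ℕ × ℕ => (2:ℕ) ^ (2 * p.1 + 2) := by fun_prop
  have h3 : Computable fun p : ℕ × ℕ × ℕ => (3 * 2 ^ p.1 - 2) * 2 ^ p.2.1 * 2 ^ (4 * p.1 + 3) := by
    fun_prop
  exact c_le (c_mul h1 h2) h3

theorem c_tau (hW : Computable fun p : ℕ × ℕ × ℕ => W p.1 p.2.1 p.2.2) :
    Computable fun p : ℕ × ℕ => tau W p.1 p.2 := by
  have h := c_okNode W hW
  unfold tau
  generalize okNode W = ok at *
  fun_prop

theorem tau_lt (s n : ℕ) : tau W s n < 2 ^ n := by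
  induction n with
  | zero => simp [tau_zero]
  | succ n ih =>
    rw [tau_succ, pow_succ]
    cases okNode W (n+1) s (2 * tau W s n) <;> simp <;> omega

theorem mass_split (m s n u : ℕ) (h : n + 1 ≤ s) :
    mass W m s n u = mass W m s (n+1) (2*u) + mass W m s (n+1) (2*u+1) := by
  unfold mass
  have e : s - n = (s - (n+1)) + 1 := by omega
  rw [e, pow_succ, mul_two, Finset.sum_range_add]
  congr 1
  · refine Finset.sum_congr rfl fun w _ => ?_
    congr 1; ring
  · refine Finset.sum_congr rfl fun w _ => ?_
    congr 1; ring

theorem mass_mono {m s n u : ℕ} (hn : n ≤ s) (hu : u < 2 ^ n) (hr : ¬ Resets W m s) :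
    2 * mass W m s n u ≤ mass W m (s+1) n u := by
  unfold Resets at hr
  push Not at hr
  unfold mass
  have e : s + 1 - n = (s - n) + 1 := by omega
  rw [e, pow_succ, mul_comm (2 ^ (s-n)) 2, ← sum_half (fun w => W m s (u * 2 ^ (s-n) + w))]
  refine Finset.sum_le_sum fun w hw => ?_
  rw [Finset.mem_range] at hw
  have h1 : u * (2 * 2 ^ (s-n)) + w < 2 ^ (s+1) := by
    have : 2 ^ (s+1) = 2 ^ n * (2 * 2 ^ (s-n)) := by
      rw [← pow_succ', ← pow_add]; congr 1; omega
    rw [this]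
    calc u * (2 * 2 ^ (s-n)) + w < u * (2 * 2 ^ (s-n)) + 2 * 2 ^ (s-n) := by omega
      _ = (u + 1) * (2 * 2 ^ (s-n)) := by ring
      _ ≤ _ := Nat.mul_le_mul_right _ hu
  have h2 := hr _ h1
  rwa [show (u * (2 * 2 ^ (s-n)) + w) / 2 = u * 2 ^ (s-n) + w / 2 by
    rw [show u * (2 * 2 ^ (s-n)) = 2 * (u * 2 ^ (s-n)) by ring]; omega] at h2

theorem mass_le_root (m s n u : ℕ) (h : n ≤ s) (hu : u < 2 ^ n) :
    mass W m s n u ≤ ∑ v ∈ Finset.range (2 ^ s), W m s v := by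
  induction n generalizing u with
  | zero =>
    have : u = 0 := by simpa using hu
    subst this
    simp [mass]
  | succ n ih =>
    refine le_trans ?_ (ih (u / 2) (by omega) (by rw [pow_succ] at hu; omega))
    rw [mass_split W m s n _ h]
    rcases Nat.even_or_odd' u with ⟨k, rfl | rfl⟩
    · rw [show 2 * k / 2 = k by omega]; omega
    · rw [show (2 * k + 1) / 2 = k by omega]; omega

/-- the rational form of `okNode` -/
theorem okNode_iff (n s u : ℕ) : okNode W n s u = true ↔
    (∑ m ∈ Finset.range (2*n+1), (mass W m s n u : ℚ) / 2 ^ (2*m+3)) * 2 ^ n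
      ≤ (3/4 - 1/2^(n+1)) * 2 ^ s := by
  unfold okNode
  rw [decide_eq_true_eq]
  have h2 : 2 ≤ 3 * 2 ^ n := by have := Nat.one_le_two_pow (n := n); omega
  rw [← Nat.cast_le (α := ℚ)]
  push_cast [Nat.cast_sub h2]
  have e1 : (∑ m ∈ Finset.range (2*n+1), (mass W m s n u : ℚ) * 2 ^ (4*n-2*m)) =
      (∑ m ∈ Finset.range (2*n+1), (mass W m s n u : ℚ) / 2 ^ (2*m+3)) * 2 ^ (4*n+3) := by
    rw [Finset.sum_mul]
    refine Finset.sum_congr rfl fun m hm => ?_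
    rw [Finset.mem_range] at hm
    rw [div_mul_eq_mul_div, mul_div_assoc]
    congr 1
    rw [eq_div_iff (by positivity), ← pow_add]
    congr 1; omega
  rw [e1]
  set X := (∑ m ∈ Finset.range (2*n+1), (mass W m s n u : ℚ) / 2 ^ (2*m+3))
  have e2 : X * 2 ^ (4*n+3) * 2 ^ (2*n+2) = (X * 2 ^ n) * (2 ^ (4*n+3) * 2 ^ (n+2)) := by ring
  have e3 : ((3:ℚ) * 2 ^ n - 2) * 2 ^ s * 2 ^ (4*n+3) =
      ((3/4 - 1/2^(n+1)) * 2 ^ s) * (2 ^ (4*n+3) * 2 ^ (n+2)) := by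
    field_simp
    ring
  rw [e2, e3]
  exact mul_le_mul_iff_left₀ (by positivity)

variable {W}

theorem okNode_mono {n s u : ℕ} (hn : n ≤ s) (hu : u < 2 ^ n)
    (hr : ∀ m < 2 * n + 1, ¬ Resets W m s) (h : okNode W n (s+1) u = true) :
    okNode W n s u = true := by
  rw [okNode_iff] at h ⊢
  have h1 : 2 * (∑ m ∈ Finset.range (2*n+1), (mass W m s n u : ℚ) / 2 ^ (2*m+3)) ≤
      (∑ m ∈ Finset.range (2*n+1), (mass W m (s+1) n u : ℚ) / 2 ^ (2*m+3)) := by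
    rw [Finset.mul_sum]
    refine Finset.sum_le_sum fun m hm => ?_
    rw [Finset.mem_range] at hm
    have h2 := mass_mono W hn hu (hr m hm)
    have h3 : (2:ℚ) * mass W m s n u ≤ mass W m (s+1) n u := by exact_mod_cast h2
    rw [← mul_div_assoc]
    gcongr
  have h2 : (2:ℚ) * (∑ m ∈ Finset.range (2*n+1), (mass W m s n u : ℚ) / 2 ^ (2*m+3)) * 2 ^ n ≤
    (3/4 - 1/2^(n+1)) * 2 ^ (s+1) := le_trans (by gcongr) h
  rw [pow_succ 2 s] at h2
  linarith

theorem okNode_tau (hsmall : ∀ m s, (∑ v ∈ Finset.range (2 ^ s), W m s v) * 2 ^ (m+2)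
      ≤ 2 ^ s * 2 ^ (2*m+3)) (s n : ℕ) (hn : n ≤ s) : okNode W n s (tau W s n) = true := by
  have small' : ∀ m n u, n ≤ s → u < 2 ^ n →
      (mass W m s n u : ℚ) / 2 ^ (2*m+3) ≤ 2 ^ s * (1/2)^(m+2) := by
    intro m n u hn hu
    have h1 := Nat.mul_le_mul_right (2 ^ (m+2)) (mass_le_root W m s n u hn hu)
    have h2 : ((mass W m s n u : ℚ)) * 2 ^ (m+2) ≤ 2 ^ s * 2 ^ (2*m+3) := by
      exact_mod_cast h1.trans (hsmall m s)
    rw [div_le_iff₀ (by positivity)]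
    have e : (1/2:ℚ)^(m+2) * 2 ^ (m+2) = 1 := by rw [← mul_pow]; norm_num
    have h3 : (0:ℚ) < 2^(m+2) := by positivity
    rw [← mul_le_mul_iff_left₀ h3]
    calc _ ≤ _ := h2
      _ = 2 ^ s * 2 ^ (2*m+3) * ((1/2:ℚ)^(m+2) * 2 ^ (m+2)) := by rw [e, mul_one]
      _ = _ := by ring
  induction n with
  | zero =>
    rw [okNode_iff]
    have := small' 0 0 (tau W s 0) hn (tau_lt W s 0)
    simp only [mul_zero, zero_add, Finset.sum_range_one, pow_zero, mul_one] at this ⊢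
    norm_num at this ⊢
    linarith
  | succ n ih =>
    have ih' := ih (by omega)
    rw [tau_succ]
    cases hc : okNode W (n+1) s (2 * tau W s n) with
    | true => simpa using hc
    | false =>
      simp only [cond_false]
      set u := tau W s n
      have hu : u < 2 ^ n := tau_lt W s n
      by_contra hcon
      rw [← Bool.not_eq_true, okNode_iff, not_le] at hc
      rw [okNode_iff, not_le] at hcon
      rw [okNode_iff] at ih'
      have hsum := add_lt_add hc hcon
      rw [← add_mul (∑ m ∈ Finset.range (2*(n+1)+1), (mass W m s (n+1) (2*u) : ℚ) / 2 ^ (2*m+3)),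
        ← Finset.sum_add_distrib] at hsum
      have e1 : ∀ m, (mass W m s (n+1) (2*u) : ℚ) / 2 ^ (2*m+3) +
          (mass W m s (n+1) (2*u+1) : ℚ) / 2 ^ (2*m+3) = (mass W m s n u : ℚ) / 2 ^ (2*m+3) := by
        intro m
        rw [mass_split W m s n u hn]
        push_cast
        ring
      simp only [e1] at hsum
      rw [show 2 * (n+1) + 1 = (2*n+1) + 1 + 1 by ring, Finset.sum_range_succ,
        Finset.sum_range_succ] at hsum
      have b1 := small' (2*n+1) n u (by omega) hu
      have b2 := small' (2*n+1+1) n u (by omega) hu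
      set X := (∑ m ∈ Finset.range (2*n+1), (mass W m s n u : ℚ) / 2 ^ (2*m+3))
      set p := (mass W (2*n+1) s n u : ℚ) / 2 ^ (2*(2*n+1)+3)
      set q := (mass W (2*n+1+1) s n u : ℚ) / 2 ^ (2*(2*n+1+1)+3)
      set t : ℚ := (1/2)^n with ht
      have ht0 : 0 < t := by positivity
      have htn : t * 2 ^ n = 1 := by rw [ht, ← mul_pow]; norm_num
      have f1 : (1/2:ℚ)^(2*n+1+2) = t*t/8 := by rw [ht]; ring
      have f2 : (1/2:ℚ)^(2*n+1+1+2) = t*t/16 := by rw [ht]; ring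
      have f3 : (1:ℚ)/2^(n+1) = t/2 := by rw [ht, one_div_pow, pow_succ]; field_simp
      have f4 : (1:ℚ)/2^(n+1+1) = t/4 := by rw [ht, one_div_pow, pow_succ, pow_succ]; field_simp; norm_num
      rw [f1] at b1
      rw [f2] at b2
      rw [f3] at ih'
      rw [f4, pow_succ 2 n] at hsum
      have hp : p * 2 ^ n ≤ 2 ^ s * t / 8 := by
        calc p * 2 ^ n ≤ (2 ^ s * (t*t/8)) * 2 ^ n := by gcongr
          _ = 2 ^ s * t / 8 * (t * 2 ^ n) := by ring
          _ = _ := by rw [htn, mul_one]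
      have hq : q * 2 ^ n ≤ 2 ^ s * t / 16 := by
        calc q * 2 ^ n ≤ (2 ^ s * (t*t/16)) * 2 ^ n := by gcongr
          _ = 2 ^ s * t / 16 * (t * 2 ^ n) := by ring
          _ = _ := by rw [htn, mul_one]
      have hs0 : (0:ℚ) < 2 ^ s * t := by positivity
      nlinarith

theorem tau_mono (s n : ℕ) (hn : n ≤ s) (hr : ∀ m < 2 * n + 1, ¬ Resets W m s) :
    tau W s n ≤ tau W (s+1) n := by
  induction n with
  | zero => simp [tau_zero]
  | succ n ih =>
    have ih' := ih (by omega) (fun m hm => hr m (by omega))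
    rw [tau_succ, tau_succ]
    rcases ih'.lt_or_eq with h | h
    · cases okNode W (n+1) s (2 * tau W s n) <;>
        cases okNode W (n+1) (s+1) (2 * tau W (s+1) n) <;> simp <;> omega
    · rw [← h]
      have := okNode_mono (W := W) (u := 2 * tau W s n) hn
        (by have := tau_lt W s n; rw [pow_succ]; omega) hr
      cases h1 : okNode W (n+1) s (2 * tau W s n) <;>
        cases h2 : okNode W (n+1) (s+1) (2 * tau W s n) <;> simp_all

open Classical in
theorem tau_changes (n S : ℕ) :
    ((Finset.range S).filter fun s => tau W s n ≠ tau W (s+1) n).card ≤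
      tau W S n + 2 ^ n *
        ((Finset.range S).filter fun s => s < n ∨ ∃ m < 2*n+1, Resets W m s).card := by
  induction S with
  | zero => simp
  | succ S ih =>
    rw [count_succ, count_succ]
    have h1 := tau_lt W S n
    by_cases hb : S < n ∨ ∃ m < 2*n+1, Resets W m S
    · rw [if_pos hb, mul_add, mul_one]
      split_ifs <;> omega
    · rw [if_neg hb, add_zero]
      push Not at hb
      have := tau_mono (W := W) S n hb.1 hb.2
      split_ifs <;> omega

theorem c_g (f : ℕ → ℕ) (hf : Computable f) : Computable
    (fun n => 2 ^ n + 2 ^ n * (n + ∑ m ∈ Finset.range (2*n+1), f m)) := by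
  have h1 : Computable (fun n => ∑ m ∈ Finset.range (2*n+1), f m) := by fun_prop
  have h2 : Computable (fun n : ℕ => 2 ^ n) := by fun_prop
  exact c_add h2 (c_mul h2 (c_add c_id h1))

variable (W) in
theorem c_Zs (hW : Computable fun p : ℕ × ℕ × ℕ => W p.1 p.2.1 p.2.2) :
    Computable fun p : ℕ × ℕ => decide (tau W p.1 (p.2+1) % 2 = 1) := by
  have := c_tau W hW
  generalize tau W = t at *
  exact c_eq (by fun_prop) (by fun_prop)

open Classical in
theorem avoid (hW : Computable fun p : ℕ × ℕ × ℕ => W p.1 p.2.1 p.2.2)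
    (f : ℕ → ℕ) (hf : Computable f)
    (hsmall : ∀ m s, (∑ v ∈ Finset.range (2 ^ s), W m s v) * 2 ^ (m+2) ≤ 2 ^ s * 2 ^ (2*m+3))
    (hres : ∀ m S, ((Finset.range S).filter (Resets W m)).card ≤ f m) :
    ∃ Z : ℕ → Bool, OmegaCA Z ∧ ∀ m n, ∃ s₀, ∀ s, s₀ ≤ s → n ≤ s →
      ∃ v < 2 ^ s, v / 2 ^ (s - n) = pre Z n ∧ W m s v < 2 ^ (2*m+3) := by
  set g : ℕ → ℕ := fun n => 2 ^ n + 2 ^ n * (n + ∑ m ∈ Finset.range (2*n+1), f m) with hg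
  have hcount : ∀ n S, ((Finset.range S).filter fun s => tau W s n ≠ tau W (s+1) n).card ≤ g n := by
    intro n S
    refine (tau_changes (W := W) n S).trans ?_
    have h1 := tau_lt W S n
    have h2 : ((Finset.range S).filter fun s => s < n ∨ ∃ m < 2*n+1, Resets W m s).card ≤
        n + ∑ m ∈ Finset.range (2*n+1), f m := by
      have hsub : ((Finset.range S).filter fun s => s < n ∨ ∃ m < 2*n+1, Resets W m s) ⊆
          Finset.range n ∪
            (Finset.range (2*n+1)).biUnion (fun m => (Finset.range S).filter (Resets W m)) := by
        intro x hx
        simp only [Finset.mem_filter, Finset.mem_range, Finset.mem_union, Finset.mem_biUnion] at hx ⊢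
        rcases hx with ⟨hx, h | ⟨m, hm, h⟩⟩
        · exact Or.inl h
        · exact Or.inr ⟨m, hm, hx, h⟩
      refine (Finset.card_le_card hsub).trans ((Finset.card_union_le _ _).trans ?_)
      rw [Finset.card_range]
      refine Nat.add_le_add_left (Finset.card_biUnion_le.trans ?_) _
      exact Finset.sum_le_sum fun m _ => hres m S
    have := Nat.mul_le_mul_left (2 ^ n) h2
    simp only [hg]
    omega
  set Zs : ℕ → ℕ → Bool := fun s x => decide (tau W s (x+1) % 2 = 1) with hZs
  have hpre : ∀ s n, pre (Zs s) n = tau W s n := by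
    intro s n
    induction n with
    | zero => rfl
    | succ n ih =>
      rw [pre_succ, ih]
      have h : (Zs s n).toNat = tau W s (n+1) % 2 := by
        simp only [hZs]
        rcases Nat.mod_two_eq_zero_or_one (tau W s (n+1)) with h | h <;> simp [h]
      rw [h, tau_succ]
      cases okNode W (n+1) s (2 * tau W s n) <;> simp <;> omega
  have hfin : ∀ n, {s | tau W s n ≠ tau W (s+1) n}.Finite ∧
      {s | tau W s n ≠ tau W (s+1) n}.ncard ≤ g n := fun n => ncard_of_count _ _ (hcount n)
  have hlim : ∀ n, ∃ t, ∀ s, t ≤ s → tau W s n = tau W t n := by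
    intro n
    obtain ⟨t, ht⟩ := (hfin n).1.bddAbove
    refine ⟨t+1, fun s hs => ?_⟩
    induction s, hs using Nat.le_induction with
    | base => rfl
    | succ s hs ih =>
      rw [← ih]
      by_contra hc
      have := ht (show s ∈ {s | tau W s n ≠ tau W (s+1) n} from fun h => hc h.symm)
      omega
  choose t ht using hlim
  set Z : ℕ → Bool := fun x => Zs (t (x+1)) x with hZ
  have happ : ∀ x s, t (x+1) ≤ s → Zs s x = Z x := by
    intro x s hs
    simp only [hZ, hZs]
    rw [ht (x+1) s hs]
  have hpreZ : ∀ n, ∃ s₀, ∀ s, s₀ ≤ s → tau W s n = pre Z n := by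
    intro n
    refine ⟨(Finset.range n).sup (fun x => t (x+1)), fun s hs => ?_⟩
    rw [← hpre, pre_eq_iff]
    intro i hi
    exact happ i s (le_trans (Finset.le_sup (f := fun x => t (x+1)) (Finset.mem_range.2 hi)) hs)
  have hcg : Computable g := c_g f hf
  have hcZs := c_Zs W hW
  refine ⟨Z, ⟨g, hcg, Zs, ⟨?_, fun x => ⟨t (x+1), happ x⟩⟩, fun n => ?_⟩, ?_⟩
  · exact hcZs
  · have e : changeStages Zs n = Nat.succ '' {s | tau W s n ≠ tau W (s+1) n} := by
      ext s
      simp only [changeStages, Set.mem_setOf_eq, Set.mem_image, ne_eq, restr_eq_iff, hpre]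
      constructor
      · rintro ⟨h1, h2⟩
        refine ⟨s - 1, fun h => h2 ?_, by omega⟩
        rw [show s - 1 + 1 = s by omega] at h
        exact h.symm
      · rintro ⟨r, h1, rfl⟩
        exact ⟨by omega, fun h => h1 (by simpa using h.symm)⟩
    rw [e]
    exact ⟨(hfin n).1.image _, (Set.ncard_image_le (hfin n).1).trans (hfin n).2⟩
  · intro m n
    obtain ⟨s₀, hs₀⟩ := hpreZ (max n m)
    refine ⟨max s₀ (max n m), fun s hs hns => ?_⟩
    have hk : max n m ≤ s := le_trans (le_max_right _ _) hs
    have htau := hs₀ s (le_trans (le_max_left _ _) hs)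
    set k := max n m with hkdef
    have hok := okNode_tau hsmall s k hk
    rw [okNode_iff, htau] at hok
    by_contra hcon
    push Not at hcon
    have hlow : (2 ^ (s - k) * 2 ^ (2*m+3)) ≤ mass W m s k (pre Z k) := by
      unfold mass
      calc _ = ∑ w ∈ Finset.range (2 ^ (s-k)), 2 ^ (2*m+3) := by simp
        _ ≤ _ := by
          refine Finset.sum_le_sum fun w hw => ?_
          rw [Finset.mem_range] at hw
          have hlt := pre_lt Z k
          have hdiv : (pre Z k * 2 ^ (s-k) + w) / 2 ^ (s-k) = pre Z k := by
            rw [mul_comm, Nat.mul_add_div (by positivity), Nat.div_eq_of_lt hw, add_zero]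
          refine hcon _ ?_ ?_
          · have : 2 ^ s = 2 ^ k * 2 ^ (s-k) := by rw [← pow_add]; congr 1; omega
            rw [this]
            calc pre Z k * 2 ^ (s-k) + w < pre Z k * 2 ^ (s-k) + 2 ^ (s-k) := by omega
              _ = (pre Z k + 1) * 2 ^ (s-k) := by ring
              _ ≤ _ := Nat.mul_le_mul_right _ hlt
          · have hnk : n ≤ k := le_max_left _ _
            rw [show s - n = (s - k) + (k - n) by omega, pow_add, ← Nat.div_div_eq_div_mul, hdiv,
              pre_div' Z hnk]
    have h1 : (2:ℚ) ^ (s-k) ≤ (mass W m s k (pre Z k) : ℚ) / 2 ^ (2*m+3) := by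
      rw [le_div_iff₀ (by positivity)]
      exact_mod_cast hlow
    have h2 : (mass W m s k (pre Z k) : ℚ) / 2 ^ (2*m+3) ≤
        ∑ m ∈ Finset.range (2*k+1), (mass W m s k (pre Z k) : ℚ) / 2 ^ (2*m+3) := by
      refine Finset.single_le_sum (f := fun m => (mass W m s k (pre Z k) : ℚ) / 2 ^ (2*m+3))
        (fun i _ => by positivity) (Finset.mem_range.2 ?_)
      have : m ≤ k := le_max_right _ _
      omega
    have h3 : (2:ℚ) ^ s = 2 ^ (s-k) * 2 ^ k := by rw [← pow_add]; congr 1; omega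
    have h4 : (2:ℚ) ^ s ≤ (3/4 - 1/2^(k+1)) * 2 ^ s := by
      refine le_trans ?_ hok
      rw [h3]
      exact mul_le_mul_of_nonneg_right (h1.trans h2) (by positivity)
    have h5 : (0:ℚ) < 2 ^ s := by positivity
    have h6 : (0:ℚ) < 1/2^(k+1) := by positivity
    nlinarith

end Avoid


/-! ## Oracle computability -/

theorem RecIn.of_partrec {O f : ℕ →. ℕ} (h : Nat.Partrec f) : RecIn O f := by
  induction h with
  | zero => exact RecIn.zero
  | succ => exact RecIn.succ
  | left => exact RecIn.left
  | right => exact RecIn.right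
  | pair _ _ h1 h2 => exact RecIn.pair h1 h2
  | comp _ _ h1 h2 => exact RecIn.comp h1 h2
  | prec _ _ h1 h2 => exact RecIn.prec h1 h2
  | rfind _ h1 => exact RecIn.rfind h1

theorem RecIn.of_eq {O f g : ℕ →. ℕ} (h : RecIn O f) (H : ∀ n, f n = g n) : RecIn O g :=
  (funext H : f = g) ▸ h

theorem RecIn.of_comp {O : ℕ →. ℕ} {f : ℕ → ℕ} (h : Computable f) : RecIn O (f : ℕ →. ℕ) :=
  RecIn.of_partrec (Partrec.nat_iff.1 h)

theorem RecIn.comp_tot {O : ℕ →. ℕ} {f g : ℕ → ℕ} (hf : RecIn O fun n => Part.some (f n))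
    (hg : RecIn O fun n => Part.some (g n)) : RecIn O fun n => Part.some (f (g n)) :=
  (RecIn.comp hf hg).of_eq (fun n => Part.bind_some _ _)

theorem RecIn.pair_tot {O : ℕ →. ℕ} {f g : ℕ → ℕ} (hf : RecIn O fun n => Part.some (f n))
    (hg : RecIn O fun n => Part.some (g n)) : RecIn O fun n => Part.some (Nat.pair (f n) (g n)) :=
  (RecIn.pair hf hg).of_eq (fun n => by simp [Seq.seq])

theorem RecIn.of_comp' {O : ℕ →. ℕ} {f : ℕ → ℕ} (h : Computable f) :
    RecIn O fun n => Part.some (f n) :=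
  RecIn.of_comp h

theorem RecIn.pre (Z : ℕ → Bool) : RecIn (charFn Z) (fun n => Part.some (Nat.pair n (pre Z n))) := by
  have h0 : RecIn (charFn Z) (fun n => Part.some ((Z n).toNat)) :=
    RecIn.oracle.of_eq (fun n => by unfold charFn; cases Z n <;> rfl)
  have h2 := RecIn.comp_tot h0 (RecIn.of_comp' (f := fun p : ℕ => p.unpair.2.unpair.1) (by fun_prop))
  have h4 := RecIn.pair_tot
    (RecIn.of_comp' (O := charFn Z) (f := fun p : ℕ => 2 * p.unpair.2.unpair.2) (by fun_prop)) h2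
  have h6 := RecIn.comp_tot
    (RecIn.of_comp' (O := charFn Z) (f := fun p : ℕ => p.unpair.1 + p.unpair.2) (by fun_prop)) h4
  have hz := RecIn.of_comp' (O := charFn Z) (f := fun _ : ℕ => 0) (by fun_prop)
  have h7 : RecIn (charFn Z) (fun p => Part.some (_root_.pre Z p.unpair.2)) := by
    refine (RecIn.prec hz h6).of_eq (fun p => ?_)
    unfold Nat.unpaired
    induction p.unpair.2 with
    | zero => rfl
    | succ n ih =>
      simp only [ih, pre_succ]
      simp only [Part.bind_eq_bind, Part.bind_some, Nat.unpair_pair]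
  have h9 := RecIn.comp_tot h7 (RecIn.of_comp' (f := fun p : ℕ => Nat.pair 0 p) (by fun_prop))
  refine (RecIn.pair_tot (RecIn.of_comp' (f := fun p : ℕ => p) (by fun_prop)) h9).of_eq (fun n => ?_)
  simp only [Nat.unpair_pair]

/-- the finite oracle information of length `n` -/
def oInfo (Z : ℕ → Bool) (n : ℕ) : ℕ := Nat.pair n (pre Z n)

/-- `f` is computed by a partial computable functional with finite use along `Z`. -/
def UseExt (Z : ℕ → Bool) (f : ℕ →. ℕ) : Prop :=
  ∃ F : ℕ → ℕ →. ℕ, Partrec₂ F ∧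
    (∀ n n' a y, n ≤ n' → y ∈ F (oInfo Z n) a → y ∈ F (oInfo Z n') a) ∧
    (∀ n a y, y ∈ F (oInfo Z n) a → y ∈ f a) ∧
    (∀ a y, y ∈ f a → ∃ n, y ∈ F (oInfo Z n) a)

theorem UseExt.of_partrec (Z : ℕ → Bool) {f : ℕ →. ℕ} (h : Nat.Partrec f) : UseExt Z f :=
  ⟨fun _ a => f a, (Partrec.nat_iff.2 h).comp Computable.snd, fun _ _ _ _ _ h => h, fun _ _ _ h => h,
    fun _ _ h => ⟨0, h⟩⟩

/-- look up the bit `a` in finite oracle information -/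
def obit (o a : ℕ) : Option ℕ :=
  bif ltb a o.unpair.1 then some ((o.unpair.2 / 2 ^ (o.unpair.1 - (a+1))) % 2) else none

theorem c_obit : Computable fun p : ℕ × ℕ => obit p.1 p.2 := by
  have h1 : Computable fun p : ℕ × ℕ => ltb p.2 p.1.unpair.1 := by fun_prop
  have h2 : Computable fun p : ℕ × ℕ => 2 ^ (p.1.unpair.1 - (p.2+1)) := by fun_prop
  have h3 : Computable fun p : ℕ × ℕ => p.1.unpair.2 := by fun_prop
  have h4 : Computable fun p : ℕ × ℕ => 2 := by fun_prop
  exact Computable.cond h1 (c_some (c_mod (c_div h3 h2) h4)) (Computable.const none)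

theorem obit_iff (Z : ℕ → Bool) (n a y : ℕ) :
    obit (oInfo Z n) a = some y ↔ a < n ∧ y = (Z a).toNat := by
  unfold oInfo obit
  rw [Nat.unpair_pair]
  by_cases h : a < n
  · have h1 : pre Z n / 2 ^ (n - (a+1)) = pre Z (a+1) := pre_div' Z h
    simp only [ltb_iff.2 h, cond_true, h1, pre_succ, h, true_and]
    have := Bool.toNat_le (Z a)
    rw [show (2 * pre Z a + (Z a).toNat) % 2 = (Z a).toNat by omega, Option.some.injEq]
    exact eq_comm
  · simp [h, ltb_iff'.2 h]

theorem UseExt.oracle (Z : ℕ → Bool) : UseExt Z (charFn Z) := by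
  refine ⟨fun o a => (obit o a : Part ℕ), Computable.ofOption c_obit, ?_, ?_, ?_⟩
  all_goals simp only [Part.mem_coe, Option.mem_def, obit_iff]
  · rintro n n' a y h ⟨h1, h2⟩
    exact ⟨by omega, h2⟩
  · rintro n a y ⟨h1, rfl⟩
    unfold charFn
    cases Z a <;> simp
  · intro a y hy
    refine ⟨a+1, by omega, ?_⟩
    unfold charFn at hy
    cases h : Z a <;> simp_all

theorem UseExt.pair {Z : ℕ → Bool} {f g : ℕ →. ℕ} (hf : UseExt Z f) (hg : UseExt Z g) :
    UseExt Z (fun n => Nat.pair <$> f n <*> g n) := by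
  obtain ⟨F, hF, mF, sF, cF⟩ := hf
  obtain ⟨G, hG, mG, sG, cG⟩ := hg
  refine ⟨fun o a => (F o a).bind fun x => (G o a).map fun y => Nat.pair x y, ?_, ?_, ?_, ?_⟩
  · refine Partrec.bind hF ?_
    refine Partrec.map (hG.comp (Computable.fst.comp Computable.fst) (Computable.snd.comp Computable.fst)) ?_
    have : Computable (fun p : ((ℕ×ℕ)×ℕ)×ℕ => Nat.pair p.1.2 p.2) := by fun_prop
    exact this
  · intro n n' a y h hy
    simp only [Part.mem_bind_iff, Part.mem_map_iff] at hy ⊢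
    obtain ⟨x, hx, z, hz, rfl⟩ := hy
    exact ⟨x, mF _ _ _ _ h hx, z, mG _ _ _ _ h hz, rfl⟩
  · intro n a y hy
    simp only [Part.mem_bind_iff, Part.mem_map_iff] at hy
    obtain ⟨x, hx, z, hz, rfl⟩ := hy
    simp only [Seq.seq, Part.map_eq_map, Part.bind_eq_bind, Part.mem_bind_iff, Part.mem_map_iff]
    exact ⟨Nat.pair x, ⟨x, sF _ _ _ hx, rfl⟩, z, sG _ _ _ hz, rfl⟩
  · intro a y hy
    simp only [Seq.seq, Part.map_eq_map, Part.bind_eq_bind, Part.mem_bind_iff, Part.mem_map_iff] at hy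
    obtain ⟨_, ⟨x, hx, rfl⟩, z, hz, rfl⟩ := hy
    obtain ⟨n1, h1⟩ := cF _ _ hx
    obtain ⟨n2, h2⟩ := cG _ _ hz
    refine ⟨max n1 n2, ?_⟩
    simp only [Part.mem_bind_iff, Part.mem_map_iff]
    exact ⟨x, mF _ _ _ _ (le_max_left _ _) h1, z, mG _ _ _ _ (le_max_right _ _) h2, rfl⟩

theorem UseExt.comp {Z : ℕ → Bool} {f g : ℕ →. ℕ} (hf : UseExt Z f) (hg : UseExt Z g) :
    UseExt Z (fun n => g n >>= f) := by
  obtain ⟨F, hF, mF, sF, cF⟩ := hf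
  obtain ⟨G, hG, mG, sG, cG⟩ := hg
  refine ⟨fun o a => (G o a).bind fun x => F o x, ?_, ?_, ?_, ?_⟩
  · refine Partrec.bind hG ?_
    exact hF.comp (Computable.fst.comp Computable.fst) Computable.snd
  · intro n n' a y h hy
    simp only [Part.mem_bind_iff] at hy ⊢
    obtain ⟨x, hx, hz⟩ := hy
    exact ⟨x, mG _ _ _ _ h hx, mF _ _ _ _ h hz⟩
  · intro n a y hy
    simp only [Part.mem_bind_iff] at hy
    obtain ⟨x, hx, hz⟩ := hy
    exact Part.mem_bind_iff.2 ⟨x, sG _ _ _ hx, sF _ _ _ hz⟩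
  · intro a y hy
    obtain ⟨x, hx, hz⟩ := Part.mem_bind_iff.1 hy
    obtain ⟨n1, h1⟩ := cG _ _ hx
    obtain ⟨n2, h2⟩ := cF _ _ hz
    exact ⟨max n1 n2, Part.mem_bind_iff.2
      ⟨x, mG _ _ _ _ (le_max_left _ _) h1, mF _ _ _ _ (le_max_right _ _) h2⟩⟩

/-- primitive recursion on partial values -/
def prc (f : Part ℕ) (g : ℕ → ℕ →. ℕ) (k : ℕ) : Part ℕ :=
  Nat.rec (motive := fun _ => Part ℕ) f (fun y IH => IH.bind fun i => g y i) k

theorem prc_mono {f f' : Part ℕ} {g g' : ℕ → ℕ →. ℕ} (h : ∀ y ∈ f, y ∈ f')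
    (h2 : ∀ k i, ∀ y ∈ g k i, y ∈ g' k i) (k : ℕ) : ∀ y ∈ prc f g k, y ∈ prc f' g' k := by
  induction k with
  | zero => exact h
  | succ k ih =>
    intro y hy
    obtain ⟨i, hi, hz⟩ := Part.mem_bind_iff.1 hy
    exact Part.mem_bind_iff.2 ⟨i, ih _ hi, h2 _ _ _ hz⟩

theorem UseExt.prec {Z : ℕ → Bool} {f g : ℕ →. ℕ} (hf : UseExt Z f) (hg : UseExt Z g) :
    UseExt Z (Nat.unpaired fun a n =>
      n.rec (f a) fun y IH => do let i ← IH; g (Nat.pair a (Nat.pair y i))) := by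
  obtain ⟨F, hF, mF, sF, cF⟩ := hf
  obtain ⟨G, hG, mG, sG, cG⟩ := hg
  change UseExt Z (fun p => prc (f p.unpair.1)
    (fun y i => g (Nat.pair p.unpair.1 (Nat.pair y i))) p.unpair.2)
  have mono : ∀ n n' p k y, n ≤ n' → y ∈ prc (F (oInfo Z n) p)
      (fun y i => G (oInfo Z n) (Nat.pair p (Nat.pair y i))) k →
      y ∈ prc (F (oInfo Z n') p)
      (fun y i => G (oInfo Z n') (Nat.pair p (Nat.pair y i))) k := fun n n' p k y h hy =>
    prc_mono (fun y => mF _ _ _ _ h) (fun k i y => mG _ _ _ _ h) _ _ hy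
  refine ⟨fun o p => prc (F o p.unpair.1)
    (fun y i => G o (Nat.pair p.unpair.1 (Nat.pair y i))) p.unpair.2, ?_, ?_, ?_, ?_⟩
  · refine Partrec.nat_rec (f := fun q : ℕ × ℕ => q.2.unpair.2) (g := fun q : ℕ × ℕ => F q.1 q.2.unpair.1)
      (h := fun q r => G q.1 (Nat.pair q.2.unpair.1 (Nat.pair r.1 r.2))) (by fun_prop) ?_ ?_
    · exact hF.comp (by fun_prop) (by fun_prop)
    · have h1 : Computable (fun q : (ℕ×ℕ)×(ℕ×ℕ) => q.1.1) := by fun_prop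
      have h2 : Computable (fun q : (ℕ×ℕ)×(ℕ×ℕ) => Nat.pair q.1.2.unpair.1 (Nat.pair q.2.1 q.2.2)) := by
        fun_prop
      exact hG.comp h1 h2
  · intro n n' p y h hy
    exact mono _ _ _ _ _ h hy
  · intro n p y hy
    exact prc_mono (fun y => sF _ _ _) (fun k i y => sG _ _ _) _ _ hy
  · intro p y hy
    simp only at hy ⊢
    revert hy
    generalize p.unpair.2 = k
    induction k generalizing y with
    | zero => exact fun hy => cF _ _ hy
    | succ k ih =>
      intro hy
      change y ∈ (prc _ _ k).bind _ at hy
      rw [Part.mem_bind_iff] at hy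
      obtain ⟨i, hi, hz⟩ := hy
      obtain ⟨n1, h1⟩ := ih _ hi
      obtain ⟨n2, h2⟩ := cG _ _ hz
      refine ⟨max n1 n2, ?_⟩
      change y ∈ (prc _ _ k).bind _
      rw [Part.mem_bind_iff]
      exact ⟨i, mono _ _ _ _ _ (le_max_left _ _) h1, mG _ _ _ _ (le_max_right _ _) h2⟩

theorem mem_rfind_zero (p : ℕ → Part ℕ) (y : ℕ) :
    y ∈ (Nat.rfind fun n => (p n).map fun m => decide (m = 0)) ↔
      (0 ∈ p y ∧ ∀ m < y, ∃ z ∈ p m, z ≠ 0) := by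
  refine Iff.trans Nat.mem_rfind ?_
  constructor
  · rintro ⟨h1, h2⟩
    obtain ⟨x, hx, h⟩ := (Part.mem_map_iff _).1 h1
    rw [decide_eq_true_eq] at h
    refine ⟨h ▸ hx, fun m hm => ?_⟩
    obtain ⟨z, hz, h⟩ := (Part.mem_map_iff _).1 (h2 hm)
    exact ⟨z, hz, by simpa using h⟩
  · rintro ⟨h1, h2⟩
    refine ⟨(Part.mem_map_iff _).2 ⟨0, h1, rfl⟩, fun {m} hm => ?_⟩
    obtain ⟨z, hz, h⟩ := h2 m hm
    exact (Part.mem_map_iff _).2 ⟨z, hz, by simpa using h⟩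

theorem UseExt.rfind {Z : ℕ → Bool} {f : ℕ →. ℕ} (hf : UseExt Z f) :
    UseExt Z (fun a => Nat.rfind fun n => (fun m => m = 0) <$> f (Nat.pair a n)) := by
  obtain ⟨F, hF, mF, sF, cF⟩ := hf
  refine ⟨fun o a => Nat.rfind fun n => (F o (Nat.pair a n)).map fun m => decide (m = 0), ?_, ?_, ?_, ?_⟩
  · refine Partrec.rfind (p := fun q : ℕ × ℕ => fun n => (F q.1 (Nat.pair q.2 n)).map fun m => decide (m = 0)) ?_
    refine Partrec.map (f := fun q : (ℕ × ℕ) × ℕ => F q.1.1 (Nat.pair q.1.2 q.2)) (g := fun _ m => decide (m = 0)) ?_ ?_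
    · have h1 : Computable (fun q : (ℕ × ℕ) × ℕ => q.1.1) := by fun_prop
      have h2 : Computable (fun q : (ℕ × ℕ) × ℕ => Nat.pair q.1.2 q.2) := by fun_prop
      exact hF.comp h1 h2
    · have : Computable (fun p : ((ℕ×ℕ)×ℕ)×ℕ => decide (p.2 = 0)) := c_eq (by fun_prop) (by fun_prop)
      exact this
  · intro n n' a y h hy
    obtain ⟨h1, h2⟩ := (mem_rfind_zero (fun k => F (oInfo Z n) (Nat.pair a k)) y).1 hy
    refine (mem_rfind_zero (fun k => F (oInfo Z n') (Nat.pair a k)) y).2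
      ⟨mF _ _ _ _ h h1, fun m hm => ?_⟩
    obtain ⟨z, hz, h3⟩ := h2 m hm
    exact ⟨z, mF _ _ _ _ h hz, h3⟩
  · intro n a y hy
    obtain ⟨h1, h2⟩ := (mem_rfind_zero (fun k => F (oInfo Z n) (Nat.pair a k)) y).1 hy
    refine (mem_rfind_zero (fun k => f (Nat.pair a k)) y).2
      ⟨sF _ _ _ h1, fun m hm => ?_⟩
    obtain ⟨z, hz, h3⟩ := h2 m hm
    exact ⟨z, sF _ _ _ hz, h3⟩
  · intro a y hy
    obtain ⟨h1, h2⟩ := (mem_rfind_zero (fun k => f (Nat.pair a k)) y).1 hy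
    obtain ⟨n1, hn1⟩ := cF _ _ h1
    have h3 : ∀ m, ∃ n2, m < y → ∃ z, z ∈ F (oInfo Z n2) (Nat.pair a m) ∧ z ≠ 0 := by
      intro m
      by_cases hm : m < y
      · obtain ⟨z, hz, h3⟩ := h2 m hm
        obtain ⟨n2, hn2⟩ := cF _ _ hz
        exact ⟨n2, fun _ => ⟨z, hn2, h3⟩⟩
      · exact ⟨0, fun h => absurd h hm⟩
    choose N hN using h3
    refine ⟨max n1 ((Finset.range y).sup N), (mem_rfind_zero (fun k => F (oInfo Z _) (Nat.pair a k)) y).2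
      ⟨mF _ _ _ _ (le_max_left _ _) hn1, fun m hm => ?_⟩⟩
    obtain ⟨z, hz, h3⟩ := hN m hm
    exact ⟨z, mF _ _ _ _ (le_trans (Finset.le_sup (f := N) (Finset.mem_range.2 hm)) (le_max_right _ _)) hz, h3⟩

theorem UseExt.of_recIn {Z : ℕ → Bool} {f : ℕ →. ℕ} (h : RecIn (charFn Z) f) : UseExt Z f := by
  induction h with
  | oracle => exact UseExt.oracle Z
  | zero => exact UseExt.of_partrec Z Nat.Partrec.zero
  | succ => exact UseExt.of_partrec Z Nat.Partrec.succ
  | left => exact UseExt.of_partrec Z Nat.Partrec.left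
  | right => exact UseExt.of_partrec Z Nat.Partrec.right
  | pair _ _ h1 h2 => exact h1.pair h2
  | comp _ _ h1 h2 => exact h1.comp h2
  | prec _ _ h1 h2 => exact h1.prec h2
  | rfind _ h1 => exact h1.rfind

open Nat.Partrec (Code) in
/-- `evaln` on indices -/
def evl (e s a : ℕ) : Option ℕ := Code.evaln s (Denumerable.ofNat Code e) a

/-- `evaln`, made into a decidable relation on numbers -/
def evB (e s a y : ℕ) : Bool := decide (evl e s a = some y)

open Nat.Partrec (Code) in
theorem c_evl : Computable fun p : ℕ × ℕ × ℕ => evl p.1 p.2.1 p.2.2 := by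
  have h := Code.primrec_evaln.to_comp
  have h1 : Computable fun p : ℕ × ℕ × ℕ => ((p.2.1, Denumerable.ofNat Code p.1), p.2.2) := by
    have := Computable.ofNat Code
    fun_prop
  exact h.comp h1

theorem c_evB : Computable fun p : ℕ × ℕ × ℕ × ℕ => evB p.1 p.2.1 p.2.2.1 p.2.2.2 := by
  have := c_evl
  unfold evB
  generalize evl = E at *
  have h1 : Computable fun p : ℕ × ℕ × ℕ × ℕ => E p.1 p.2.1 p.2.2.1 := by fun_prop
  have h3 : Computable fun p : ℕ × ℕ × ℕ × ℕ => some p.2.2.2 := by fun_prop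
  exact c_eq h1 h3

theorem evB_mono {e s s' a y : ℕ} (h : s ≤ s') (h1 : evB e s a y = true) : evB e s' a y = true := by
  unfold evB evl at *
  rw [decide_eq_true_eq] at *
  exact Nat.Partrec.Code.evaln_mono h h1

open Nat.Partrec (Code) in
theorem evB_complete {f : ℕ →. ℕ} (hf : Nat.Partrec f) :
    ∃ e, ∀ a y, y ∈ f a ↔ ∃ s, evB e s a y = true := by
  obtain ⟨c, hc⟩ := Code.exists_code.1 hf
  refine ⟨Encodable.encode c, fun a y => ?_⟩
  unfold evB evl
  simp only [Denumerable.ofNat_encode, decide_eq_true_eq, ← hc, Code.evaln_complete]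
  rfl

/-- index for a Turing reduction, through finite oracle information -/
theorem turing_index {A Z : ℕ → Bool} (h : TuringLE A Z) :
    ∃ e, ∀ x b, A x = b ↔ ∃ s, ∃ n ≤ s, evB e s (Nat.pair (Nat.pair n (pre Z n)) x) b.toNat = true := by
  obtain ⟨F, hF, mF, sF, cF⟩ := UseExt.of_recIn h
  obtain ⟨e, he⟩ := evB_complete (f := fun p => F p.unpair.1 p.unpair.2)
    (Partrec.nat_iff.1 (hF.comp (by fun_prop) (by fun_prop)))
  refine ⟨e, fun x b => ?_⟩
  have hb : A x = b ↔ b.toNat ∈ charFn A x := by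
    unfold charFn
    cases A x <;> cases b <;> simp
  rw [hb]
  constructor
  · intro h
    obtain ⟨n, hn⟩ := cF _ _ h
    obtain ⟨s, hs⟩ := (he (Nat.pair (oInfo Z n) x) b.toNat).1 (by simpa using hn)
    exact ⟨max n s, n, le_max_left _ _, evB_mono (le_max_right _ _) hs⟩
  · rintro ⟨s, n, _, hs⟩
    have := (he _ _).2 ⟨s, hs⟩
    exact sF n x _ (by simpa [oInfo] using this)


/-! ## From obedience to computation below ω-c.a. randoms -/

section Forward

variable (Zs : ℕ → ℕ → Bool)

theorem c_preZ (hZ : Computable fun p : ℕ × ℕ => Zs p.1 p.2) :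
    Computable fun p : ℕ × ℕ => pre (Zs p.1) p.2 := by
  unfold pre
  fun_prop

theorem restr_succ (Y : ℕ → Bool) (n : ℕ) : restr Y (n+1) = restr Y n ++ [Y n] := by
  unfold restr
  rw [List.range_succ, List.map_append]
  rfl

theorem c_restr (hZ : Computable fun p : ℕ × ℕ => Zs p.1 p.2) :
    Computable fun p : ℕ × ℕ => restr (Zs p.1) p.2 := by
  have h1 : Computable fun q : (ℕ × ℕ) × ℕ × List Bool => q.2.2 := by fun_prop
  have h2 : Computable fun q : (ℕ × ℕ) × ℕ × List Bool => Zs q.1.1 q.2.1 := by fun_prop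
  have h3 : Computable fun q : (ℕ × ℕ) × ℕ × List Bool => q.2.2 ++ [Zs q.1.1 q.2.1] :=
    Computable.list_concat.comp h1 h2
  have h : Computable fun p : ℕ × ℕ => Nat.rec (motive := fun _ => List Bool) []
      (fun i r => r ++ [Zs p.1 i]) p.2 := by
    refine c_rec (f := fun (p : ℕ × ℕ) i r => r ++ [Zs p.1 i]) (by fun_prop) (by fun_prop) h3
  refine h.of_eq (fun p => ?_)
  induction p.2 with
  | zero => rfl
  | succ n ih => rw [restr_succ, ← ih]

/-- `pre · n` changes in the interval `(x, s]` -/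
def chg (n x s : ℕ) : Bool :=
  bex (s+1) fun t => ltb x t && !(eqb (pre (Zs t) n) (pre (Zs (t-1)) n))

theorem chg_iff (n x s : ℕ) : chg Zs n x s = true ↔
    ∃ t, x < t ∧ t ≤ s ∧ pre (Zs t) n ≠ pre (Zs (t-1)) n := by
  unfold chg
  rw [bex_iff]
  simp only [Bool.and_eq_true, ltb_iff, Bool.not_eq_true', eqb_iff']
  constructor
  · rintro ⟨t, h1, h2, h3⟩
    exact ⟨t, h2, by omega, h3⟩
  · rintro ⟨t, h1, h2, h3⟩
    exact ⟨t, by omega, h1, h3⟩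

theorem pre_eq_mono {Y Y' : ℕ → Bool} {n n' : ℕ} (h : n ≤ n') (h1 : pre Y n' = pre Y' n') :
    pre Y n = pre Y' n := by
  rw [pre_eq_iff] at *
  exact fun i hi => h1 i (by omega)

theorem chg_mono {n n' x x' s s' : ℕ} (hn : n ≤ n') (hx : x' ≤ x) (hs : s ≤ s')
    (h : chg Zs n x s = true) : chg Zs n' x' s' = true := by
  rw [chg_iff] at *
  obtain ⟨t, h1, h2, h3⟩ := h
  exact ⟨t, by omega, by omega, fun h => h3 (pre_eq_mono hn h)⟩

theorem lev_ex (q : ℕ × ℕ) : ∃ n, (leb q.1 n || chg Zs n q.1 q.2) = true :=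
  ⟨q.1, by simp⟩

/-- the level of the cost of changing `x` at stage `s` -/
def lev (x s : ℕ) : ℕ := Nat.find (lev_ex Zs (x, s))

theorem c_lev (hZ : Computable fun p : ℕ × ℕ => Zs p.1 p.2) :
    Computable fun p : ℕ × ℕ => lev Zs p.1 p.2 := by
  have h1 := c_preZ Zs hZ
  refine c_find (p := fun (q : ℕ × ℕ) n => leb q.1 n || chg Zs n q.1 q.2) ?_ (lev_ex Zs)
  unfold chg
  obtain ⟨P, hP⟩ : ∃ P : ℕ → ℕ → ℕ, ∀ t n, P t n = pre (Zs t) n := ⟨fun t n => pre (Zs t) n, fun _ _ => rfl⟩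
  simp only [← hP] at *
  clear hP
  fun_prop

theorem lev_spec (x s : ℕ) : x ≤ lev Zs x s ∨ chg Zs (lev Zs x s) x s = true := by
  have := Nat.find_spec (lev_ex Zs (x, s))
  rw [Bool.or_eq_true, leb_iff] at this
  exact this

theorem lev_le {x s n : ℕ} (h : x ≤ n ∨ chg Zs n x s = true) : lev Zs x s ≤ n :=
  Nat.find_min' (lev_ex Zs (x, s)) (by simpa using h)

theorem lev_anti {x s t : ℕ} (h : s ≤ t) : lev Zs x t ≤ lev Zs x s := by
  refine lev_le Zs ((lev_spec Zs x s).imp id fun h1 => chg_mono Zs le_rfl le_rfl h h1)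

theorem lev_mono {x y s : ℕ} (h : x ≤ y) : lev Zs x s ≤ lev Zs y s := by
  refine lev_le Zs ((lev_spec Zs y s).imp h.trans fun h1 => chg_mono Zs le_rfl h le_rfl h1)

/-- the cost function of the approximation `Zs` -/
def cZ (x s : ℕ) : ℚ := ((1:ℕ):ℚ) / ((2 ^ lev Zs x s : ℕ) : ℚ)

theorem cZ_eq (x s : ℕ) : cZ Zs x s = (1/2) ^ lev Zs x s := by
  unfold cZ
  rw [one_div_pow]
  push_cast
  rfl

theorem cZ_cost (hZ : Computable fun p : ℕ × ℕ => Zs p.1 p.2) : CostFunction (cZ Zs) := by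
  refine ⟨?_, ?_, ?_, ?_⟩
  · have h := c_lev Zs hZ
    have h2 : Computable fun p : ℕ × ℕ => 2 ^ lev Zs p.1 p.2 := by
      generalize lev Zs = L at *
      fun_prop
    exact c_frac (Computable.const 1) h2 (fun p => by positivity)
  · intro x s; rw [cZ_eq]; positivity
  · intro x s t h
    rw [cZ_eq, cZ_eq]
    exact pow_le_pow_of_le_one (by norm_num) (by norm_num) (lev_anti Zs h)
  · intro x y s h
    rw [cZ_eq, cZ_eq]
    exact pow_le_pow_of_le_one (by norm_num) (by norm_num) (lev_mono Zs h)

theorem cZ_benign (g : ℕ → ℕ) (hg : Computable g)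
    (h : ∀ n, (changeStages Zs n).Finite ∧ (changeStages Zs n).ncard ≤ g n) : Benign (cZ Zs) := by
  refine ⟨fun k => k + 1 + g k, by fun_prop, ?_⟩
  intro k m x s h1 h2 h3
  have hsx : ∀ j i, i < j → j < m → s i ≤ x j := by
    intro j
    induction j with
    | zero => intro i hi; omega
    | succ j ih =>
      intro i hi hj
      rcases Nat.lt_succ_iff_lt_or_eq.1 hi with h4 | rfl
      · have := ih i h4 (by omega)
        have := h1 j (by omega)
        have := h2 j hj
        omega
      · exact h2 i hj
  have hxi : ∀ i, i < m → i ≤ x i := by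
    intro i
    induction i with
    | zero => intro _; omega
    | succ i ih =>
      intro hi
      have := ih (by omega)
      have := h1 i (by omega)
      have := h2 i hi
      omega
  have hch : ∀ i, ∃ t, i ∈ Finset.Ico (k+1) m → x i < t ∧ t ≤ s i ∧ pre (Zs t) k ≠ pre (Zs (t-1)) k := by
    intro i
    by_cases hi : i ∈ Finset.Ico (k+1) m
    · rw [Finset.mem_Ico] at hi
      have h4 := h3 i hi.2
      rw [cZ_eq] at h4
      have h5 : lev Zs (x i) (s i) ≤ k :=
        (pow_le_pow_iff_right_of_lt_one₀ (by norm_num) (by norm_num)).1 h4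
      have h6 := hxi i hi.2
      rcases lev_spec Zs (x i) (s i) with h7 | h7
      · omega
      · obtain ⟨t, ht⟩ := (chg_iff _ _ _ _).1 (chg_mono Zs h5 le_rfl le_rfl h7)
        exact ⟨t, fun _ => ht⟩
    · exact ⟨0, fun h => absurd h hi⟩
  choose t ht using hch
  have hcard : (Finset.Ico (k+1) m).card ≤ (h k).1.toFinset.card := by
    refine Finset.card_le_card_of_injOn t ?_ ?_
    · intro i hi
      have hi' := ht i (by simpa using hi)
      simp only [Set.Finite.coe_toFinset]
      refine ⟨by omega, ?_⟩
      rw [ne_eq, restr_eq_iff]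
      exact hi'.2.2
    · intro i hi j hj hij
      have hi' := ht i (by simpa using hi)
      have hj' := ht j (by simpa using hj)
      simp only [Finset.coe_Ico, Set.mem_Ico] at hi hj
      rcases lt_trichotomy i j with h4 | h4 | h4
      · have := hsx j i h4 hj.2
        omega
      · exact h4
      · have := hsx i j h4 hi.2
        omega
  rw [← Set.ncard_eq_toFinset_card _ (h k).1, Nat.card_Ico] at hcard
  have := (h k).2
  show m ≤ k + 1 + g k
  omega

variable (As : ℕ → ℕ → Bool)

/-- `p` codes a stage together with the least change of `As` -/
def good (p : ℕ) : Bool :=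
  ltb 0 p.unpair.1 && (!(beqb (As p.unpair.1 p.unpair.2) (As (p.unpair.1 - 1) p.unpair.2)) &&
    ball p.unpair.2 fun i => beqb (As p.unpair.1 i) (As (p.unpair.1 - 1) i))

theorem good_iff (s x : ℕ) : good As (Nat.pair s x) = true ↔
    0 < s ∧ As s x ≠ As (s-1) x ∧ ∀ i < x, As s i = As (s-1) i := by
  unfold good
  simp [ball_iff]

/-- length of the `p`-th string of the test -/
def tLen (p : ℕ) : ℕ := bif good As p then lev Zs p.unpair.2 p.unpair.1 - 1 else p

theorem c_tLen (hZ : Computable fun p : ℕ × ℕ => Zs p.1 p.2)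
    (hA : Computable fun p : ℕ × ℕ => As p.1 p.2) : Computable (tLen Zs As) := by
  have h := c_lev Zs hZ
  unfold tLen good
  generalize lev Zs = L at *
  fun_prop

theorem good_cost (c : ℕ → ℕ → ℚ) {s x : ℕ} (h : good As (Nat.pair s x) = true) :
    stageCost c As s = c x s := by
  rw [good_iff] at h
  obtain ⟨h1, h2, h3⟩ := h
  unfold stageCost
  rw [if_neg (by omega), dif_pos ⟨x, h2⟩]
  congr 1
  rw [Nat.find_eq_iff]
  exact ⟨h2, fun i hi => by simpa using h3 i hi⟩

theorem summable_tLen (B : ℚ) (hB : ∀ F : Finset ℕ, ∑ s ∈ F, stageCost (cZ Zs) As s ≤ B) :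
    Summable (fun p => ((1:ℝ)/2) ^ tLen Zs As p) := by
  have hle : ∀ F : Finset ℕ, ∑ p ∈ F, (if good As p = true then ((1:ℝ)/2) ^ tLen Zs As p else 0) ≤ 2 * (B:ℝ) := by
    intro F
    rw [← Finset.sum_filter]
    have h1 : ∀ p ∈ F.filter (fun p => good As p = true), ((1:ℝ)/2) ^ tLen Zs As p ≤
        2 * ((stageCost (cZ Zs) As p.unpair.1 : ℚ) : ℝ) := by
      intro p hp
      have hg := (Finset.mem_filter.1 hp).2
      have hg' := hg
      rw [← Nat.pair_unpair p] at hg'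
      rw [good_cost As _ hg', cZ_eq]
      unfold tLen
      rw [hg]
      simp only [cond_true]
      push_cast
      rcases Nat.eq_zero_or_pos (lev Zs p.unpair.2 p.unpair.1) with h0 | h0
      · rw [h0]; norm_num
      · obtain ⟨k, hk⟩ : ∃ k, lev Zs p.unpair.2 p.unpair.1 = k + 1 := ⟨_, (Nat.succ_pred_eq_of_pos h0).symm⟩
        rw [hk, Nat.add_sub_cancel, pow_succ]
        linarith
    refine (Finset.sum_le_sum h1).trans ?_
    rw [← Finset.mul_sum]
    have hinj : Set.InjOn (fun p : ℕ => p.unpair.1) (F.filter (fun p => good As p = true) : Finset ℕ) := by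
      intro p hp q hq hpq
      have hp' := (Finset.mem_filter.1 hp).2
      have hq' := (Finset.mem_filter.1 hq).2
      rw [← Nat.pair_unpair p, good_iff] at hp'
      rw [← Nat.pair_unpair q, good_iff] at hq'
      simp only at hpq
      rw [← hpq] at hq'
      have : p.unpair.2 = q.unpair.2 := by
        rcases lt_trichotomy p.unpair.2 q.unpair.2 with h | h | h
        · exact absurd (hq'.2.2 _ h) hp'.2.1
        · exact h
        · exact absurd (hp'.2.2 _ h) hq'.2.1
      rw [← Nat.pair_unpair p, ← Nat.pair_unpair q, hpq, this]
    have h2 := hB ((F.filter (fun p => good As p = true)).image (fun p : ℕ => p.unpair.1))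
    rw [Finset.sum_image hinj] at h2
    have h3 : ((∑ p ∈ F.filter (fun p => good As p = true), stageCost (cZ Zs) As p.unpair.1 : ℚ) : ℝ) ≤ B := by
      exact_mod_cast h2
    push_cast at h3
    linarith
  have hs1 : Summable (fun p => if good As p = true then ((1:ℝ)/2) ^ tLen Zs As p else 0) :=
    summable_of_sum_le (fun p => by dsimp only; split_ifs <;> positivity) hle
  have hs2 : Summable (fun p : ℕ => ((1:ℝ)/2) ^ p) := summable_geometric_two
  refine Summable.of_nonneg_of_le (fun p => by positivity) (fun p => ?_) (hs1.add hs2)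
  by_cases hg : good As p = true
  · rw [if_pos hg]
    have : (0:ℝ) ≤ (1/2)^p := by positivity
    linarith
  · rw [if_neg hg, zero_add]
    rw [Bool.not_eq_true] at hg
    unfold tLen
    rw [hg]
    simp

theorem finite_table (A : ℕ → Bool) (N : ℕ) : ∃ h : ℕ → Bool, Computable h ∧ ∀ x < N, h x = A x := by
  induction N with
  | zero => exact ⟨fun _ => false, by fun_prop, fun x hx => by omega⟩
  | succ N ih =>
    obtain ⟨h, hc, hh⟩ := ih
    refine ⟨fun x => bif eqb x N then A N else h x, by fun_prop, fun x hx => ?_⟩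
    rcases Nat.lt_succ_iff_lt_or_eq.1 hx with h1 | rfl
    · have : eqb x N = false := by simp; omega
      simp [this, hh x h1]
    · have : eqb x x = true := by simp
      simp [this]

variable {Zs As}

theorem agree_of_not_chg {n x s t : ℕ} (h : chg Zs n x s = false) (h1 : x ≤ t) (h2 : t ≤ s) :
    pre (Zs t) n = pre (Zs s) n := by
  induction s, h2 using Nat.le_induction with
  | base => rfl
  | succ s hs ih =>
    have h3 : chg Zs n x s = false := by
      rw [← Bool.not_eq_true] at *
      exact fun h4 => h (chg_mono Zs le_rfl le_rfl (Nat.le_succ s) h4)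
    rw [ih h3]
    by_contra hc
    rw [← Bool.not_eq_true, chg_iff] at h
    exact h ⟨s+1, by omega, le_rfl, fun h5 => hc h5.symm⟩

theorem forward_main {A Z : ℕ → Bool} (hZ : Computable fun p : ℕ × ℕ => Zs p.1 p.2)
    (hA : Computable fun p : ℕ × ℕ => As p.1 p.2) (apZ : Approx Zs Z) (apA : Approx As A)
    (hml : MLRandom Z) (B : ℚ) (hB : ∀ F : Finset ℕ, ∑ s ∈ F, stageCost (cZ Zs) As s ≤ B) :
    TuringLE A Z := by
  have hlen : ∀ p, (restr (Zs p.unpair.1) (tLen Zs As p)).length = tLen Zs As p := by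
    intro p; simp [restr]
  have hfin := hml (fun p => restr (Zs p.unpair.1) (tLen Zs As p)) (by
    have h1 := c_restr Zs hZ
    have h2 := c_tLen Zs As hZ hA
    exact h1.comp (f := fun p : ℕ × ℕ => restr (Zs p.1) p.2)
      (g := fun p : ℕ => (p.unpair.1, tLen Zs As p)) (by fun_prop))
    (by simp only [hlen]; exact summable_tLen Zs As B hB)
  obtain ⟨N, hN⟩ := hfin.bddAbove
  have key : ∀ x t, N ≤ x → x < t → pre (Zs t) x = pre Z x → As t x = A x := by
    intro x t hx ht hpre
    have hstep : ∀ s, t ≤ s → As s x = As t x := by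
      intro s hs
      induction s, hs using Nat.le_induction with
      | base => rfl
      | succ s hs ih =>
        rw [← ih]
        by_contra hc
        have hex : ∃ y, As (s+1) y ≠ As s y := ⟨x, hc⟩
        classical
        obtain ⟨y, hy, hmin, hyx⟩ : ∃ y, As (s+1) y ≠ As s y ∧ (∀ i < y, As (s+1) i = As s i) ∧ y ≤ x :=
          ⟨Nat.find hex, Nat.find_spec hex, fun i hi => by simpa using Nat.find_min hex hi,
            Nat.find_min' hex hc⟩
        have hgood : good As (Nat.pair (s+1) y) = true := by
          rw [good_iff]
          exact ⟨by omega, by simpa using hy, by simpa using hmin⟩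
        have hmem : InitSeg (restr (Zs (Nat.pair (s+1) y).unpair.1) (tLen Zs As (Nat.pair (s+1) y))) Z := by
          unfold InitSeg
          rw [hlen, restr_eq_iff]
          unfold tLen
          rw [hgood, Nat.unpair_pair]
          simp only [cond_true]
          rcases Nat.eq_zero_or_pos (lev Zs y (s+1)) with h0 | h0
          · rw [h0]; rfl
          · have hle : lev Zs y (s+1) ≤ y := lev_le Zs (Or.inl le_rfl)
            have hnc : chg Zs (lev Zs y (s+1) - 1) y (s+1) = false := by
              rw [← Bool.not_eq_true]
              intro h
              have := lev_le Zs (Or.inr h)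
              omega
            rw [← agree_of_not_chg hnc (t := t) (by omega) (by omega)]
            exact pre_eq_mono (by omega) hpre
        have h1 := hN hmem
        have h2 := Nat.left_le_pair (s+1) y
        omega
    obtain ⟨r, hr⟩ := apA x
    rw [← hr (max r t) (le_max_left _ _), hstep (max r t) (le_max_right _ _)]
  obtain ⟨tab, htab, hh⟩ := finite_table A N
  have hcp := c_preZ Zs hZ
  have hs : ∀ x, ∃ t, x < t ∧ pre (Zs t) x = pre Z x := by
    intro x
    choose r hr using apZ
    refine ⟨max (x+1) ((Finset.range x).sup r), by omega, ?_⟩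
    rw [pre_eq_iff]
    intro i hi
    exact hr i _ (le_trans (Finset.le_sup (f := r) (Finset.mem_range.2 hi)) (le_max_right _ _))
  have hp : Partrec fun p : ℕ => (Nat.rfind fun t =>
      Part.some (ltb p.unpair.1 t && eqb (pre (Zs t) p.unpair.1) p.unpair.2)).map
      (fun t => (bif ltb p.unpair.1 N then tab p.unpair.1 else As t p.unpair.1).toNat) := by
    refine Partrec.map (Partrec.rfind (p := fun (p : ℕ) => fun t =>
      Part.some (ltb p.unpair.1 t && eqb (pre (Zs t) p.unpair.1) p.unpair.2)) ?_)
      (g := fun (p : ℕ) t => (bif ltb p.unpair.1 N then tab p.unpair.1 else As t p.unpair.1).toNat) ?_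
    · have : Computable fun q : ℕ × ℕ => (ltb q.1.unpair.1 q.2 && eqb (pre (Zs q.2) q.1.unpair.1) q.1.unpair.2) := by
        obtain ⟨P, hP⟩ : ∃ P : ℕ → ℕ → ℕ, ∀ t n, P t n = pre (Zs t) n := ⟨fun t n => pre (Zs t) n, fun _ _ => rfl⟩
        simp only [← hP] at hcp ⊢
        clear hP
        fun_prop
      exact this.partrec
    · have : Computable fun q : ℕ × ℕ => (bif ltb q.1.unpair.1 N then tab q.1.unpair.1 else As q.2 q.1.unpair.1).toNat := by
        fun_prop
      exact this
  refine (RecIn.comp (RecIn.of_partrec (Partrec.nat_iff.1 hp)) (RecIn.pre Z)).of_eq (fun x => ?_)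
  refine (Part.bind_some _ _).trans ?_
  refine Part.eq_some_iff.2 ?_
  rw [Nat.unpair_pair, Part.mem_map_iff]
  classical
  refine ⟨Nat.find (hs x), ?_, ?_⟩
  · refine Nat.mem_rfind.2 ⟨?_, fun {m} hm => ?_⟩
    · have := Nat.find_spec (hs x)
      simpa using this
    · have := Nat.find_min (hs x) hm
      simpa using this
  · have hspec := Nat.find_spec (hs x)
    by_cases hx : x < N
    · rw [ltb_iff.2 hx]
      simp only [cond_true, hh x hx]
      cases A x <;> rfl
    · rw [ltb_iff'.2 hx]
      simp only [cond_false]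
      rw [key x _ (by omega) hspec.1 hspec.2]
      cases A x <;> rfl

end Forward

theorem forward (A : ℕ → Bool) (h : ∀ c, CostFunction c → Benign c → Obeys A c)
    (Z : ℕ → Bool) (hml : MLRandom Z) (hω : OmegaCA Z) : TuringLE A Z := by
  obtain ⟨g, hg, Zs, ⟨hZ, apZ⟩, hch⟩ := hω
  obtain ⟨As, ⟨hA, apA⟩, B, hB⟩ := h (cZ Zs) (cZ_cost Zs hZ) (cZ_benign Zs g hg hch)
  exact forward_main hZ hA apZ apA hml B hB


/-! ## Counting lemmas and the randomness requirements -/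

section Counting

theorem sum_lift (g : ℕ → ℕ) (k d : ℕ) :
    ∑ v ∈ Finset.range (k * 2 ^ d), g (v / 2 ^ d) = 2 ^ d * ∑ v ∈ Finset.range k, g v := by
  induction d with
  | zero => simp
  | succ d ih =>
    have h1 := sum_half (fun v => g (v / 2 ^ d)) (k * 2 ^ d)
    rw [ih] at h1
    have h2 : k * 2 ^ (d+1) = 2 * (k * 2 ^ d) := by ring
    have h3 : ∀ v, g (v / 2 ^ (d+1)) = g (v / 2 / 2 ^ d) := by
      intro v
      rw [Nat.div_div_eq_div_mul, pow_succ']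
    rw [h2, Finset.sum_congr rfl (fun v _ => h3 v), h1]
    ring

theorem sum_lift' (g : ℕ → ℕ) {t s : ℕ} (h : t ≤ s) :
    ∑ v ∈ Finset.range (2 ^ s), g (v / 2 ^ (s - t)) = 2 ^ (s - t) * ∑ v ∈ Finset.range (2 ^ t), g v := by
  rw [← sum_lift, ← pow_add]
  congr 3
  omega

theorem div_lt_pow {v s t : ℕ} (h : t ≤ s) (hv : v < 2 ^ s) : v / 2 ^ (s - t) < 2 ^ t := by
  rw [Nat.div_lt_iff_lt_mul (by positivity), ← pow_add]
  rwa [show t + (s - t) = s by omega]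

theorem div_div_pow (v : ℕ) {s t r : ℕ} (h : t ≤ s) (h2 : r ≤ t) :
    v / 2 ^ (s - t) / 2 ^ (t - r) = v / 2 ^ (s - r) := by
  rw [Nat.div_div_eq_div_mul, ← pow_add]
  congr 2
  omega

theorem div_succ_pow (v : ℕ) {s t : ℕ} (h : t ≤ s) :
    v / 2 / 2 ^ (s - t) = v / 2 ^ (s + 1 - t) := by
  have := div_div_pow v (s := s+1) (t := s) (r := t) (by omega) h
  rw [← this]
  simp

theorem card_cyl (N d u : ℕ) :
    ∑ v ∈ Finset.range N, (eqb (v / 2 ^ d) u).toNat ≤ 2 ^ d := by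
  have h1 : ∑ v ∈ Finset.range N, (eqb (v / 2 ^ d) u).toNat
      = ((Finset.range N).filter (fun v => v / 2 ^ d = u)).card := by
    rw [Finset.card_filter]
    refine Finset.sum_congr rfl (fun v _ => ?_)
    by_cases h : v / 2 ^ d = u
    · simp [eqb, h]
    · simp [eqb, h]
  rw [h1]
  have h2 : ((Finset.range N).filter (fun v => v / 2 ^ d = u)) ⊆
      Finset.Ico (u * 2 ^ d) (u * 2 ^ d + 2 ^ d) := by
    intro v hv
    simp only [Finset.mem_filter] at hv
    have h3 := hv.2
    rw [Finset.mem_Ico, ← h3]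
    have h4 := Nat.div_add_mod v (2 ^ d)
    have h5 := Nat.mod_lt v (show 2 ^ d > 0 by positivity)
    rw [mul_comm]
    omega
  refine (Finset.card_le_card h2).trans ?_
  rw [Nat.card_Ico, Nat.add_sub_cancel_left]

open Classical in
theorem count_resets (R K L : ℕ → Prop) 
    (h1 : ∀ s, R s → ¬ K s → ¬ L s ∧ L (s+1)) (h2 : ∀ s, ¬ K s → L s → L (s+1)) (S : ℕ) :
    ((Finset.range S).filter R).card ≤ 2 * ((Finset.range S).filter K).card + 1 := by
  have : ((Finset.range S).filter R).card ≤ 2 * ((Finset.range S).filter K).card +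
      if L S then 1 else 0 := by
    induction S with
    | zero => simp
    | succ S ih =>
      rw [count_succ, count_succ]
      by_cases hK : K S
      · rw [if_pos hK]
        split_ifs at * <;> omega
      · rw [if_neg hK]
        have a := h1 S
        have b := h2 S hK
        by_cases hR : R S
        · have := a hR hK
          rw [if_pos hR, if_pos this.2]
          rw [if_neg this.1] at ih
          omega
        · rw [if_neg hR]
          by_cases hL : L S
          · rw [if_pos (b hL)]
            rw [if_pos hL] at ih
            omega
          · rw [if_neg hL] at ih
            omega
  refine this.trans ?_
  split_ifs <;> omega

end Counting

section RPart

/-- the code of the output of `evl` -/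
def evo (e s i : ℕ) : ℕ := Encodable.encode (evl e s i)

theorem c_evo : Computable fun p : ℕ × ℕ × ℕ => evo p.1 p.2.1 p.2.2 :=
  Computable.encode.comp c_evl

theorem evo_iff {e s i y : ℕ} : evo e s i = y + 1 ↔ evB e s i y = true := by
  unfold evo evB
  rw [decide_eq_true_eq]
  cases h : evl e s i with
  | none => simp
  | some z => simp

/-- the `i`-th string of test `e` is an initial segment of `v` -/
def rhit (e s i v : ℕ) : Bool :=
  ltb 0 (evo e s i) && (leb (evo e s i - 1).unpair.1 s &&
    eqb (v / 2 ^ (s - (evo e s i - 1).unpair.1)) (evo e s i - 1).unpair.2)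

theorem rhit_iff {e s i v : ℕ} : rhit e s i v = true ↔
    ∃ l u, evB e s i (Nat.pair l u) = true ∧ l ≤ s ∧ v / 2 ^ (s - l) = u := by
  unfold rhit
  simp only [Bool.and_eq_true, ltb_iff, leb_iff, eqb_iff]
  constructor
  · rintro ⟨h1, h2, h3⟩
    refine ⟨_, _, ?_, h2, h3⟩
    rw [Nat.pair_unpair, ← evo_iff]
    omega
  · rintro ⟨l, u, h1, h2, h3⟩
    rw [← evo_iff] at h1
    simp [h1, h2, h3]

theorem rhit_mono {e s i v : ℕ} (h : rhit e s i (v/2) = true) : rhit e (s+1) i v = true := by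
  rw [rhit_iff] at *
  obtain ⟨l, u, h1, h2, h3⟩ := h
  exact ⟨l, u, evB_mono (by omega) h1, by omega, by rw [← h3, div_succ_pow v h2]⟩

theorem c_rhit : Computable fun p : ℕ × ℕ × ℕ × ℕ => rhit p.1 p.2.1 p.2.2.1 p.2.2.2 := by
  have := c_evo
  unfold rhit
  generalize evo = E at *
  fun_prop

/-- number of strings of test `e` which are prefixes of `v` -/
def rr (e s v : ℕ) : ℕ := ∑ i ∈ Finset.range s, (rhit e s i v).toNat

theorem toNat_mono {a b : Bool} (h : a = true → b = true) : a.toNat ≤ b.toNat := by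
  cases a <;> cases b <;> simp_all

theorem rr_mono (e s v : ℕ) : rr e s (v/2) ≤ rr e (s+1) v := by
  unfold rr
  rw [Finset.sum_range_succ]
  refine le_trans (Finset.sum_le_sum (fun i _ => toNat_mono rhit_mono)) (Nat.le_add_right _ _)

/-- total number of hits -/
def rtot (e s : ℕ) : ℕ := ∑ v ∈ Finset.range (2 ^ s), rr e s v

theorem rtot_mono (e s : ℕ) : 2 * rtot e s ≤ rtot e (s+1) := by
  unfold rtot
  rw [← sum_half, ← pow_succ']
  exact Finset.sum_le_sum (fun v _ => rr_mono e s v)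

/-- weight for the randomness requirement -/
def WR (m s v : ℕ) : ℕ :=
  bif leb (rtot m.unpair.1 s) (2 ^ (s + m.unpair.2)) then 2 ^ (m - m.unpair.2) * rr m.unpair.1 s v else 0

theorem c_WR : Computable fun p : ℕ × ℕ × ℕ => WR p.1 p.2.1 p.2.2 := by
  have h0 := c_rhit
  have h1 : Computable fun p : ℕ × ℕ × ℕ => rr p.1 p.2.1 p.2.2 := by
    unfold rr
    generalize rhit = E at *
    fun_prop
  have h2 : Computable fun p : ℕ × ℕ => rtot p.1 p.2 := by
    unfold rtot
    generalize rr = E at *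
    fun_prop
  unfold WR
  generalize rr = E at *
  generalize rtot = E2 at *
  fun_prop

theorem WR_small (m s : ℕ) :
    (∑ v ∈ Finset.range (2 ^ s), WR m s v) * 2 ^ (m+3) ≤ 2 ^ s * 2 ^ (2*m+3) := by
  unfold WR
  by_cases h : leb (rtot m.unpair.1 s) (2 ^ (s + m.unpair.2)) = true
  · simp only [h, cond_true]
    rw [leb_iff] at h
    rw [← Finset.mul_sum]
    have h2 := Nat.unpair_right_le m
    calc 2 ^ (m - m.unpair.2) * rtot m.unpair.1 s * 2 ^ (m+3)
        ≤ 2 ^ (m - m.unpair.2) * 2 ^ (s + m.unpair.2) * 2 ^ (m+3) := by gcongr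
      _ = 2 ^ s * 2 ^ (2*m+3) := by
        rw [← pow_add, ← pow_add, ← pow_add]
        congr 1
        omega
  · rw [Bool.not_eq_true] at h
    simp [h]

open Classical in
theorem WR_resets (m S : ℕ) : ((Finset.range S).filter (Resets WR m)).card ≤ 1 := by
  have := count_resets (Resets WR m) (fun _ => False) 
    (fun s => ¬ rtot m.unpair.1 s ≤ 2 ^ (s + m.unpair.2)) ?_ ?_ S
  · simpa using this
  · intro s hR _
    unfold Resets at hR
    push Not at hR
    obtain ⟨v, hv, h⟩ := hR
    unfold WR at h
    by_cases h1 : leb (rtot m.unpair.1 s) (2 ^ (s + m.unpair.2)) = true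
    · by_cases h2 : leb (rtot m.unpair.1 (s+1)) (2 ^ (s + 1 + m.unpair.2)) = true
      · exfalso
        rw [h1, h2, cond_true, cond_true] at h
        have := Nat.mul_le_mul_left (2 ^ (m - m.unpair.2)) (rr_mono m.unpair.1 s v)
        omega
      · exact ⟨by simpa using h1, by simpa using h2⟩
    · rw [Bool.not_eq_true] at h1
      rw [h1, cond_false] at h
      omega
  · intro s _ h
    have h1 := rtot_mono m.unpair.1 s
    have h2 : 2 ^ (s + 1 + m.unpair.2) = 2 * 2 ^ (s + m.unpair.2) := by ring
    rw [h2]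
    omega

/-- the number coded by a string -/
def val (σ : List Bool) : ℕ := σ.foldl (fun a b => 2 * a + b.toNat) 0

theorem val_restr (Y : ℕ → Bool) (n : ℕ) : val (restr Y n) = pre Y n := by
  induction n with
  | zero => rfl
  | succ n ih =>
    rw [restr_succ, pre_succ, ← ih]
    unfold val
    rw [List.foldl_append]
    rfl

theorem c_val : Computable val := by
  refine Primrec.to_comp ?_
  unfold val
  refine Primrec.list_foldl (h := fun _ (p : ℕ × Bool) => 2 * p.1 + p.2.toNat) Primrec.id (Primrec.const 0) ?_
  refine Primrec.nat_add.comp (Primrec.nat_mul.comp (Primrec.const 2) (Primrec.fst.comp Primrec.snd)) ?_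
  exact (Primrec.dom_bool _).comp (Primrec.snd.comp Primrec.snd)

theorem random_of_avoid (Z : ℕ → Bool) (W : ℕ → ℕ → ℕ → ℕ) (hW : ∀ m s v, WR m s v ≤ W m s v)
    (h : ∀ m n, ∃ s₀, ∀ s, s₀ ≤ s → n ≤ s →
      ∃ v < 2 ^ s, v / 2 ^ (s - n) = pre Z n ∧ W m s v < 2 ^ (2*m+3)) : MLRandom Z := by
  intro σ hσ hsum
  by_contra hinf
  have hcode : Computable fun i => Nat.pair (σ i).length (val (σ i)) := by
    have h1 := c_val.comp hσ
    have h2 := Computable.list_length.comp hσ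
    exact c_npair h2 h1
  obtain ⟨e, he⟩ := evB_complete (Partrec.nat_iff.1 hcode.partrec)
  have he1 : ∀ i, ∃ s, evB e s i (Nat.pair (σ i).length (val (σ i))) = true := by
    intro i
    exact (he i _).1 (Part.mem_some _)
  have he2 : ∀ i l u s, evB e s i (Nat.pair l u) = true → l = (σ i).length ∧ u = val (σ i) := by
    intro i l u s h1
    have := (he i (Nat.pair l u)).2 ⟨s, h1⟩
    have := Part.mem_some_iff.1 this
    exact Nat.pair_eq_pair.1 this
  obtain ⟨j, hj⟩ : ∃ j : ℕ, ∑' i, ((1:ℝ)/2)^(σ i).length ≤ 2 ^ j := by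
    obtain ⟨j, hj⟩ := pow_unbounded_of_one_lt (∑' i, ((1:ℝ)/2)^(σ i).length) (one_lt_two)
    exact ⟨j, hj.le⟩
  have htot : ∀ s, rtot e s ≤ 2 ^ (s + j) := by
    intro s
    unfold rtot rr
    rw [Finset.sum_comm]
    have h1 : ∀ i, ((∑ v ∈ Finset.range (2 ^ s), (rhit e s i v).toNat : ℕ) : ℝ) ≤ 2 ^ s * ((1:ℝ)/2)^(σ i).length := by
      intro i
      by_cases hl : (σ i).length ≤ s
      · have h2 : ∑ v ∈ Finset.range (2 ^ s), (rhit e s i v).toNat ≤ 2 ^ (s - (σ i).length) := by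
          refine le_trans (Finset.sum_le_sum (fun v _ => toNat_mono ?_)) (card_cyl (2^s) (s - (σ i).length) (val (σ i)))
          rw [rhit_iff, eqb_iff]
          rintro ⟨l, u, h3, h4, h5⟩
          obtain ⟨rfl, rfl⟩ := he2 i l u s h3
          exact h5
        calc ((∑ v ∈ Finset.range (2 ^ s), (rhit e s i v).toNat : ℕ) : ℝ) ≤ ((2 ^ (s - (σ i).length) : ℕ) : ℝ) := by exact_mod_cast h2
          _ = _ := by
            push_cast
            rw [pow_sub₀ _ (by norm_num) hl, one_div, inv_pow]
      · have h2 : ∑ v ∈ Finset.range (2 ^ s), (rhit e s i v).toNat = 0 := by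
          refine Finset.sum_eq_zero (fun v _ => ?_)
          rw [Bool.toNat_eq_zero, ← Bool.not_eq_true, rhit_iff]
          rintro ⟨l, u, h3, h4, h5⟩
          obtain ⟨rfl, rfl⟩ := he2 i l u s h3
          exact hl h4
        rw [h2]
        push_cast
        positivity
    have h2 : ((∑ i ∈ Finset.range s, ∑ v ∈ Finset.range (2 ^ s), (rhit e s i v).toNat : ℕ) : ℝ) ≤ 2 ^ s * 2 ^ j := by
      rw [Nat.cast_sum]
      refine le_trans (Finset.sum_le_sum (fun i _ => h1 i)) ?_
      rw [← Finset.mul_sum]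
      gcongr
      exact le_trans (hsum.sum_le_tsum _ (fun i _ => by positivity)) hj
    rw [← pow_add] at h2
    exact_mod_cast h2
  set m := Nat.pair e j with hm
  obtain ⟨F, hF, hcard⟩ := Set.Infinite.exists_subset_card_eq (s := {i | InitSeg (σ i) Z}) hinf (2 ^ (m + 3 + j))
  choose r hr using he1
  set s1 := F.sup (fun i => max (i+1) (max (σ i).length (r i))) with hs1
  obtain ⟨s0, hs0⟩ := h m s1
  obtain ⟨v, hv, h1, h2⟩ := hs0 (max s0 s1) (le_max_left _ _) (le_max_right _ _)
  set s := max s0 s1 with hs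
  have hF' : ∀ i ∈ F, i < s ∧ (rhit e s i v).toNat = 1 := by
    intro i hi
    have h3 : max (i+1) (max (σ i).length (r i)) ≤ s1 :=
      Finset.le_sup (f := fun i => max (i+1) (max (σ i).length (r i))) hi
    have h4 : s1 ≤ s := le_max_right _ _
    refine ⟨by omega, ?_⟩
    rw [Bool.toNat_eq_one, rhit_iff]
    refine ⟨_, _, evB_mono (by omega) (hr i), by omega, ?_⟩
    rw [← div_div_pow v h4 (by omega), h1, pre_div' Z (by omega), ← val_restr]
    exact congrArg val (hF hi).symm
  have hrr : 2 ^ (m + 3 + j) ≤ rr e s v := by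
    unfold rr
    rw [← hcard, Finset.card_eq_sum_ones]
    refine le_trans (Finset.sum_le_sum (fun i hi => (hF' i hi).2.ge)) ?_
    exact Finset.sum_le_sum_of_subset (fun i hi => Finset.mem_range.2 (hF' i hi).1)
  have h3 := hW m s v
  unfold WR at h3
  have h4 : leb (rtot m.unpair.1 s) (2 ^ (s + m.unpair.2)) = true := by
    rw [leb_iff, hm, Nat.unpair_pair]
    exact htot s
  rw [h4, cond_true] at h3
  have h5 : m.unpair.2 = j := by rw [hm, Nat.unpair_pair]
  have h6 : m.unpair.1 = e := by rw [hm, Nat.unpair_pair]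
  rw [h5, h6] at h3
  have h7 : j ≤ m := Nat.right_le_pair e j
  have h8 : 2 ^ (m - j) * 2 ^ (m + 3 + j) ≤ 2 ^ (m - j) * rr e s v := Nat.mul_le_mul_left _ hrr
  rw [← pow_add, show m - j + (m + 3 + j) = 2 * m + 3 by omega] at h8
  omega

end RPart


/-! ## The capturing requirements -/

section GPart

variable (A : ℕ → ℕ → Bool) (n : ℕ → ℕ) (P : ℕ → ℕ → ℕ → ℕ → Bool) (M : ℕ)

/-- `v` makes a wrong prediction -/
def Bv (s v : ℕ) : Bool := bex (n s) fun x => P 0 s v x && A s x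

/-- `v` correctly predicts the current approximation below `n s` -/
def Cv (s v : ℕ) : Bool := ball (n s) (fun x => P (A s x).toNat s v x) && !(Bv A n P s v)

/-- number of wrong strings -/
def nB (s : ℕ) : ℕ := ∑ v ∈ Finset.range (2 ^ s), (Bv A n P s v).toNat

/-- number of correct strings -/
def nC (s : ℕ) : ℕ := ∑ v ∈ Finset.range (2 ^ s), (Cv A n P s v).toNat

/-- discretized measure of the wrong strings -/
def lv (s : ℕ) : ℕ := nB A n P s * 2 ^ (M + 4) / 2 ^ s

/-- last stage at which the level changed -/
def tt (s : ℕ) : ℕ := Nat.rec (motive := fun _ => ℕ) 0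
  (fun i r => bif eqb (lv A n P M (i+1)) (lv A n P M i) then r else i+1) s

/-- the captured strings -/
def Uv (s v : ℕ) : Bool := (Cv A n P s v || Bv A n P s v) &&
  !(Bv A n P (tt A n P M s) (v / 2 ^ (s - tt A n P M s)))

/-- number of captured strings -/
def nU (s : ℕ) : ℕ := ∑ v ∈ Finset.range (2 ^ s), (Uv A n P M s v).toNat

/-- the weight of the capturing requirement -/
def WG (s v : ℕ) : ℕ := bif leb (nU A n P M s * 2 ^ (M + 3)) (2 ^ s) then
  (Uv A n P M s v).toNat * 2 ^ (2 * M + 3) else 0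

theorem c_G {A : ℕ → ℕ → Bool} {n : ℕ → ℕ → ℕ} {P : ℕ → ℕ → ℕ → ℕ → ℕ → Bool}
    (hA : Computable fun p : ℕ × ℕ => A p.1 p.2) (hn : Computable fun p : ℕ × ℕ => n p.1 p.2)
    (hP : Computable fun p : ℕ × ℕ × ℕ × ℕ × ℕ => P p.1 p.2.1 p.2.2.1 p.2.2.2.1 p.2.2.2.2) :
    (Computable fun p : ℕ × ℕ => nC A (n p.1) (P p.1) p.2) ∧
    (Computable fun p : ℕ × ℕ × ℕ => WG A (n p.1) (P p.1) p.1 p.2.1 p.2.2) := by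
  obtain ⟨B, hB⟩ : ∃ B : ℕ → ℕ → ℕ → Bool, ∀ m s v, B m s v = Bv A (n m) (P m) s v := ⟨fun m s v => Bv A (n m) (P m) s v, fun _ _ _ => rfl⟩
  have cB : Computable fun p : ℕ × ℕ × ℕ => B p.1 p.2.1 p.2.2 := by
    simp only [hB]
    unfold Bv
    fun_prop
  obtain ⟨C, hC⟩ : ∃ C : ℕ → ℕ → ℕ → Bool, ∀ m s v, C m s v = Cv A (n m) (P m) s v := ⟨fun m s v => Cv A (n m) (P m) s v, fun _ _ _ => rfl⟩
  have cC : Computable fun p : ℕ × ℕ × ℕ => C p.1 p.2.1 p.2.2 := by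
    simp only [hC]
    unfold Cv
    simp only [← hB]
    fun_prop
  obtain ⟨L, hL⟩ : ∃ L : ℕ → ℕ → ℕ, ∀ m s, L m s = lv A (n m) (P m) m s := ⟨fun m s => lv A (n m) (P m) m s, fun _ _ => rfl⟩
  have cL : Computable fun p : ℕ × ℕ => L p.1 p.2 := by
    simp only [hL]
    unfold lv nB
    simp only [← hB]
    fun_prop
  obtain ⟨T, hT⟩ : ∃ T : ℕ → ℕ → ℕ, ∀ m s, T m s = tt A (n m) (P m) m s := ⟨fun m s => tt A (n m) (P m) m s, fun _ _ => rfl⟩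
  have cT : Computable fun p : ℕ × ℕ => T p.1 p.2 := by
    simp only [hT]
    unfold tt
    simp only [← hL]
    fun_prop
  obtain ⟨U, hU⟩ : ∃ U : ℕ → ℕ → ℕ → Bool, ∀ m s v, U m s v = Uv A (n m) (P m) m s v := ⟨fun m s v => Uv A (n m) (P m) m s v, fun _ _ _ => rfl⟩
  have cU : Computable fun p : ℕ × ℕ × ℕ => U p.1 p.2.1 p.2.2 := by
    simp only [hU]
    unfold Uv
    simp only [← hB, ← hC, ← hT]
    fun_prop
  obtain ⟨N, hN⟩ : ∃ N : ℕ → ℕ → ℕ, ∀ m s, N m s = nU A (n m) (P m) m s := ⟨fun m s => nU A (n m) (P m) m s, fun _ _ => rfl⟩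
  have cN : Computable fun p : ℕ × ℕ => N p.1 p.2 := by
    simp only [hN]
    unfold nU
    simp only [← hU]
    fun_prop
  constructor
  · unfold nC
    simp only [← hC]
    fun_prop
  · unfold WG
    simp only [← hN, ← hU]
    fun_prop

theorem WG_small (s : ℕ) :
    (∑ v ∈ Finset.range (2 ^ s), WG A n P M s v) * 2 ^ (M+3) ≤ 2 ^ s * 2 ^ (2*M+3) := by
  unfold WG
  by_cases h : leb (nU A n P M s * 2 ^ (M + 3)) (2 ^ s) = true
  · simp only [h, cond_true]
    rw [leb_iff] at h
    rw [← Finset.sum_mul]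
    calc nU A n P M s * 2 ^ (2 * M + 3) * 2 ^ (M+3) 
        = (nU A n P M s * 2 ^ (M + 3)) * 2 ^ (2 * M + 3) := by ring
      _ ≤ _ := Nat.mul_le_mul_right _ h
  · rw [Bool.not_eq_true] at h
    simp [h]

theorem Bv_iff {s v : ℕ} : Bv A n P s v = true ↔ ∃ x < n s, P 0 s v x = true ∧ A s x = true := by
  unfold Bv
  rw [bex_iff]
  simp

theorem Cv_iff {s v : ℕ} : Cv A n P s v = true ↔ 
    (∀ x < n s, P (A s x).toNat s v x = true) ∧ ¬ Bv A n P s v = true := by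
  unfold Cv
  rw [Bool.and_eq_true, ball_iff]
  simp

theorem tt_succ (s : ℕ) : tt A n P M (s+1) = 
    bif eqb (lv A n P M (s+1)) (lv A n P M s) then tt A n P M s else s+1 := rfl

theorem tt_le (s : ℕ) : tt A n P M s ≤ s := by
  induction s with
  | zero => exact le_refl 0
  | succ s ih =>
    rw [tt_succ]
    cases eqb (lv A n P M (s+1)) (lv A n P M s) <;> simp <;> omega

theorem lv_tt (s : ℕ) : lv A n P M (tt A n P M s) = lv A n P M s := by
  induction s with
  | zero => rfl
  | succ s ih =>
    rw [tt_succ]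
    cases h : eqb (lv A n P M (s+1)) (lv A n P M s) with
    | false => rfl
    | true =>
      rw [cond_true, ih]
      exact (eqb_iff.1 h).symm

variable (hA : ∀ s x, A s x = true → A (s+1) x = true) (hn : ∀ s, n s ≤ n (s+1))
  (hP : ∀ b s v x, P b s (v/2) x = true → P b (s+1) v x = true)

include hA hn hP in
theorem Bv_mono {s v : ℕ} (h : Bv A n P s (v/2) = true) : Bv A n P (s+1) v = true := by
  rw [Bv_iff] at *
  obtain ⟨x, h1, h2, h3⟩ := h
  exact ⟨x, lt_of_lt_of_le h1 (hn s), hP _ _ _ _ h2, hA _ _ h3⟩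

include hA hn hP in
theorem Bv_mono' {t s v : ℕ} (hts : t ≤ s) (h : Bv A n P t (v/2^(s-t)) = true) : Bv A n P s v = true := by
  obtain ⟨d, rfl⟩ := Nat.exists_eq_add_of_le hts
  induction d generalizing v with
  | zero => simpa using h
  | succ d ih =>
    refine Bv_mono A n P hA hn hP (s := t+d) (ih (by omega) ?_)
    rw [div_succ_pow v (by omega)]
    exact h

include hA in
theorem A_mono {s t x : ℕ} (h : s ≤ t) (h1 : A s x = true) : A t x = true := by
  induction t, h using Nat.le_induction with
  | base => exact h1
  | succ t _ ih => exact hA _ _ ih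

include hP in
theorem P_mono {b s t v x : ℕ} (h : s ≤ t) (h1 : P b s (v / 2 ^ (t - s)) x = true) : P b t v x = true := by
  obtain ⟨d, rfl⟩ := Nat.exists_eq_add_of_le h
  induction d generalizing v with
  | zero => simpa using h1
  | succ d ih =>
    refine hP _ (s+d) _ _ (ih (by omega) ?_)
    rw [div_succ_pow v (by omega)]
    exact h1

include hA hn hP in
theorem CB_mono {s v : ℕ} (hns : n (s+1) = n s) (h : (Cv A n P s (v/2) || Bv A n P s (v/2)) = true) :
    (Cv A n P (s+1) v || Bv A n P (s+1) v) = true := by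
  rw [Bool.or_eq_true] at *
  rcases h with h | h
  · by_cases hB : Bv A n P (s+1) v = true
    · exact Or.inr hB
    · left
      rw [Cv_iff] at *
      refine ⟨fun x hx => ?_, hB⟩
      rw [hns] at hx
      have h1 := hP _ _ _ _ (h.1 x hx)
      by_cases h2 : A (s+1) x = A s x
      · rw [h2]; exact h1
      · exfalso
        apply hB
        have h3 : A s x = false := by
          by_contra h4
          rw [Bool.not_eq_false] at h4
          exact h2 ((hA _ _ h4).trans h4.symm)
        rw [Bv_iff]
        refine ⟨x, by omega, ?_, ?_⟩
        · rw [h3] at h1; exact h1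
        · rw [h3] at h2
          simpa using h2
  · exact Or.inr (Bv_mono A n P hA hn hP h)

/-- the parameters change at stage `s` -/
def KK (s : ℕ) : Prop := n (s+1) ≠ n s ∨ lv A n P M (s+1) ≠ lv A n P M s

theorem tt_of_notK {s : ℕ} (h : ¬ KK A n P M s) : tt A n P M (s+1) = tt A n P M s := by
  unfold KK at h
  push Not at h
  rw [tt_succ, eqb_iff.2 h.2, cond_true]

include hA hn hP in
theorem Uv_mono {s v : ℕ} (hK : ¬ KK A n P M s) (h : Uv A n P M s (v/2) = true) : Uv A n P M (s+1) v = true := by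
  have ht := tt_of_notK A n P M hK
  have hle := tt_le A n P M s
  unfold KK at hK
  push Not at hK
  unfold Uv at *
  rw [Bool.and_eq_true] at *
  refine ⟨CB_mono A n P hA hn hP hK.1 h.1, ?_⟩
  rw [ht, ← div_succ_pow v hle]
  exact h.2

include hA hn hP in
theorem nU_mono {s : ℕ} (hK : ¬ KK A n P M s) : 2 * nU A n P M s ≤ nU A n P M (s+1) := by
  unfold nU
  rw [← sum_half, ← pow_succ']
  exact Finset.sum_le_sum (fun v _ => toNat_mono (Uv_mono A n P M hA hn hP hK))

include hA hn hP in
theorem nB_mono (s : ℕ) : 2 * nB A n P s ≤ nB A n P (s+1) := by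
  unfold nB
  rw [← sum_half, ← pow_succ']
  exact Finset.sum_le_sum (fun v _ => toNat_mono (Bv_mono A n P hA hn hP))

include hA hn hP in
theorem lv_mono (s : ℕ) : lv A n P M s ≤ lv A n P M (s+1) := by
  unfold lv
  have h := nB_mono A n P hA hn hP s
  rw [pow_succ' 2 s, ← Nat.div_div_eq_div_mul]
  refine Nat.div_le_div_right ?_
  rw [Nat.le_div_iff_mul_le (by norm_num)]
  calc nB A n P s * 2 ^ (M+4) * 2 = 2 * nB A n P s * 2 ^ (M+4) := by ring
    _ ≤ _ := Nat.mul_le_mul_right _ h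

theorem lv_le (s : ℕ) : lv A n P M s ≤ 2 ^ (M+4) := by
  unfold lv
  have : nB A n P s ≤ 2 ^ s := by
    unfold nB
    refine le_trans (Finset.sum_le_sum (fun v _ => Bool.toNat_le _)) ?_
    simp
  refine le_trans (Nat.div_le_div_right (Nat.mul_le_mul_right _ this)) ?_
  rw [Nat.mul_div_cancel_left _ (by positivity)]

open Classical in
include hA hn hP in
theorem lv_changes (S : ℕ) : ((Finset.range S).filter (fun s => lv A n P M (s+1) ≠ lv A n P M s)).card ≤ 2 ^ (M+4) := by
  refine le_trans ?_ (lv_le A n P M S)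
  induction S with
  | zero => simp
  | succ S ih =>
    rw [count_succ]
    have := lv_mono A n P M hA hn hP S
    split_ifs <;> omega

open Classical in
include hA hn hP in
theorem KK_count (S : ℕ) : ((Finset.range S).filter (KK A n P M)).card ≤ 
    ((Finset.range S).filter (fun s => n (s+1) ≠ n s)).card + 2 ^ (M+4) := by
  refine le_trans ?_ (Nat.add_le_add_left (lv_changes A n P M hA hn hP S) _)
  refine le_trans (Finset.card_le_card ?_) (Finset.card_union_le _ _)
  intro s
  unfold KK
  simp only [Finset.mem_filter, Finset.mem_union]
  tauto

/-- too many captured strings -/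
def LL (s : ℕ) : Prop := ¬ nU A n P M s * 2 ^ (M + 3) ≤ 2 ^ s

include hA hn hP in
theorem LL_mono {s : ℕ} (hK : ¬ KK A n P M s) (hL : LL A n P M s) : LL A n P M (s+1) := by
  have h := Nat.mul_le_mul_right (2 ^ (M+3)) (nU_mono A n P M hA hn hP hK)
  unfold LL at *
  rw [pow_succ' 2 s]
  rw [mul_assoc] at h
  omega

/-- the requirement is reset -/
def RG (s : ℕ) : Prop := ¬ ∀ v < 2 ^ (s+1), WG A n P M s (v / 2) ≤ WG A n P M (s+1) v

open Classical in
include hA hn hP in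
theorem WG_resets (S : ℕ) :
    ((Finset.range S).filter (RG A n P M)).card ≤
    2 * (((Finset.range S).filter (fun s => n (s+1) ≠ n s)).card + 2 ^ (M+4)) + 1 := by
  refine le_trans (count_resets _ (KK A n P M) (LL A n P M) ?_ ?_ S) 
    (Nat.add_le_add_right (Nat.mul_le_mul_left 2 (KK_count A n P M hA hn hP S)) 1)
  · intro s hR hK
    unfold RG at hR
    push Not at hR
    obtain ⟨v, hv, h⟩ := hR
    unfold WG at h
    unfold LL
    by_cases h1 : leb (nU A n P M s * 2 ^ (M + 3)) (2 ^ s) = true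
    · by_cases h2 : leb (nU A n P M (s+1) * 2 ^ (M + 3)) (2 ^ (s+1)) = true
      · exfalso
        rw [h1, h2, cond_true, cond_true] at h
        have := Nat.mul_le_mul_right (2 ^ (2 * M + 3)) (toNat_mono (Uv_mono A n P M hA hn hP (v := v) hK))
        omega
      · exact ⟨by simpa using h1, by simpa using h2⟩
    · rw [Bool.not_eq_true] at h1
      rw [h1, cond_false] at h
      omega
  · intro s hK hL
    exact LL_mono A n P M hA hn hP hK hL

/-- eventual stability from a bound on the number of changes -/
theorem stable_of_count (K : ℕ → Prop) [DecidablePred K] (g : ℕ) 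
    (h : ∀ S, ((Finset.range S).filter K).card ≤ g) : ∃ s0, ∀ s, s0 ≤ s → ¬ K s := by
  obtain ⟨h1, _⟩ := ncard_of_count K g h
  obtain ⟨b, hb⟩ := h1.bddAbove
  refine ⟨b+1, fun s hs hK => ?_⟩
  have := hb hK
  omega

include hA hn hP in
theorem density (Ainf Z : ℕ → Bool) (hlim : ∀ x, ∃ t, ∀ s, t ≤ s → A s x = Ainf x)
    (hZ : ∀ x b, Ainf x = b ↔ ∃ s, P b.toNat s (pre Z s) x = true)
    (s0 : ℕ) (hK : ∀ s, s0 ≤ s → ¬ KK A n P M s)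
    (hav : ∀ l, ∃ s₀, ∀ s, s₀ ≤ s → l ≤ s →
      ∃ v < 2 ^ s, v / 2 ^ (s - l) = pre Z l ∧ WG A n P M s v < 2 ^ (2*M+3)) :
    ∃ s1, ∀ s, s1 ≤ s → 2 ^ s < nC A n P s * 2 ^ (M + 4) := by
  have hAinf : ∀ s x, A s x = true → Ainf x = true := by
    intro s x h
    obtain ⟨t, ht⟩ := hlim x
    rw [← ht (max s t) (le_max_right _ _)]
    exact A_mono A hA (le_max_left _ _) h
  have hnB : ∀ s, ¬ Bv A n P s (pre Z s) = true := by
    intro s h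
    rw [Bv_iff] at h
    obtain ⟨x, _, h1, h2⟩ := h
    have h3 := (hZ x false).2 ⟨s, h1⟩
    rw [hAinf s x h2] at h3
    exact absurd h3 (by simp)
  have hnst : ∀ s, s0 ≤ s → n s = n s0 := by
    intro s hs
    induction s, hs using Nat.le_induction with
    | base => rfl
    | succ s hs ih =>
      have := hK s hs
      unfold KK at this
      push Not at this
      rw [this.1, ih]
  have htst : ∀ s, s0 ≤ s → tt A n P M s = tt A n P M s0 := by
    intro s hs
    induction s, hs using Nat.le_induction with
    | base => rfl
    | succ s hs ih =>
      rw [tt_of_notK A n P M (hK s hs), ih]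
  have hUst : ∀ s t v, s0 ≤ s → s ≤ t → Uv A n P M s (v / 2 ^ (t - s)) = true → Uv A n P M t v = true := by
    intro s t v hs hst h
    obtain ⟨d, rfl⟩ := Nat.exists_eq_add_of_le hst
    induction d generalizing v with
    | zero => simpa using h
    | succ d ih =>
      refine Uv_mono A n P M hA hn hP (hK (s+d) (by omega)) (ih _ (by omega) ?_)
      rw [div_succ_pow v (by omega)]
      exact h
  have hcl : ∃ s1, s0 ≤ s1 ∧ LL A n P M s1 := by
    by_contra hno
    push Not at hno
    -- a stage where `Z` is captured
    choose t ht using hlim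
    have hp : ∀ x, ∃ s, P (Ainf x).toNat s (pre Z s) x = true := fun x => (hZ x _).1 rfl
    choose r hr using hp
    set s1 := max s0 ((Finset.range (n s0)).sup (fun x => max (t x) (r x))) with hs1
    have hx : ∀ x < n s0, max (t x) (r x) ≤ s1 := by
      intro x hx
      exact le_trans (Finset.le_sup (f := fun x => max (t x) (r x)) (Finset.mem_range.2 hx)) (le_max_right _ _)
    have hs01 : s0 ≤ s1 := le_max_left _ _
    have hU : Uv A n P M s1 (pre Z s1) = true := by
      unfold Uv
      rw [Bool.and_eq_true, Bool.or_eq_true]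
      refine ⟨Or.inl ?_, ?_⟩
      · rw [Cv_iff]
        refine ⟨fun x hxn => ?_, hnB s1⟩
        rw [hnst s1 hs01] at hxn
        have h1 := hx x hxn
        rw [ht x s1 (by omega)]
        refine P_mono P hP (s := r x) (by omega) ?_
        rw [pre_div' Z (by omega)]
        exact hr x
      · rw [pre_div' Z (tt_le A n P M s1)]
        simpa using hnB _
    obtain ⟨s2, hs2⟩ := hav s1
    obtain ⟨v, hv, h1, h2⟩ := hs2 (max s1 s2) (le_max_right _ _) (le_max_left _ _)
    set s := max s1 s2 with hs
    have h3 : Uv A n P M s v = true := hUst s1 s v hs01 (le_max_left _ _) (by rw [h1]; exact hU)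
    have h4 := hno s (le_trans hs01 (le_max_left _ _))
    unfold LL at h4
    push Not at h4
    unfold WG at h2
    rw [leb_iff.2 h4, cond_true, h3] at h2
    simp at h2
  obtain ⟨s1, h01, hL1⟩ := hcl
  refine ⟨s1, fun s hs => ?_⟩
  have hL : LL A n P M s := by
    induction s, hs using Nat.le_induction with
    | base => exact hL1
    | succ s hs ih => exact LL_mono A n P M hA hn hP (hK s (by omega)) ih
  set t := tt A n P M s with ht
  have hts : t ≤ s := tt_le A n P M s
  -- counting
  have hcount : nU A n P M s + 2 ^ (s - t) * nB A n P t ≤ nC A n P s + nB A n P s := by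
    unfold nU nB nC
    rw [← sum_lift' (fun v => (Bv A n P t v).toNat) hts, ← Finset.sum_add_distrib, ← Finset.sum_add_distrib]
    refine Finset.sum_le_sum (fun v _ => ?_)
    have h1 := Bv_mono' A n P hA hn hP hts (v := v)
    unfold Uv
    rw [← ht]
    cases hc : Cv A n P s v <;> cases hb : Bv A n P s v <;> cases hbt : Bv A n P t (v / 2 ^ (s - t)) <;> simp_all
  have hlv := lv_tt A n P M s
  rw [← ht] at hlv
  unfold lv at hlv
  have h2 : nB A n P s * 2 ^ (M+4) < (nB A n P t * 2 ^ (M+4) / 2 ^ t + 1) * 2 ^ s := by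
    rw [hlv]
    have := Nat.lt_div_mul_add (a := nB A n P s * 2 ^ (M+4)) (b := 2 ^ s) (by positivity)
    rw [add_mul, one_mul]
    exact this
  have h3 : nB A n P t * 2 ^ (M+4) / 2 ^ t * 2 ^ t ≤ nB A n P t * 2 ^ (M+4) := Nat.div_mul_le_self _ _
  have h4 : 2 ^ s = 2 ^ t * 2 ^ (s - t) := by rw [← pow_add]; congr 1; omega
  have h5 : nB A n P t * 2 ^ (M+4) / 2 ^ t * 2 ^ s ≤ 2 ^ (s - t) * nB A n P t * 2 ^ (M+4) := by
    rw [h4, ← mul_assoc]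
    calc _ ≤ nB A n P t * 2 ^ (M+4) * 2 ^ (s - t) := Nat.mul_le_mul_right _ h3
      _ = _ := by ring
  have h6 := Nat.mul_le_mul_right (2 ^ (M+4)) hcount
  rw [add_mul, add_mul] at h6
  rw [add_mul, one_mul] at h2
  unfold LL at hL
  have h7 : nU A n P M s * 2 ^ (M+4) = 2 * (nU A n P M s * 2 ^ (M+3)) := by ring
  omega

include hA hP in
theorem Cv_disjoint {s t v x : ℕ} (hst : s ≤ t) (hx : x < n s) (hnt : n s ≤ n t) (h0 : A s x = false) (h1 : A t x = true)
    (hs : Cv A n P s (v / 2 ^ (t - s)) = true) : ¬ Cv A n P t v = true := by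
  intro h
  rw [Cv_iff] at *
  refine h.2 ?_
  rw [Bv_iff]
  refine ⟨x, by omega, ?_, h1⟩
  have := hs.1 x hx
  rw [h0] at this
  exact P_mono P hP hst this

end GPart


/-! ## From dense correct predictions to obedience -/

section Obey

/-- `(1/2)^k < c x s`, as a computable test -/
def gtc (c : ℕ → ℕ → ℚ) (k x s : ℕ) : Bool := ltb (c x s).den ((c x s).num.natAbs * 2 ^ k)

theorem gtc_iff {c : ℕ → ℕ → ℚ} (h0 : ∀ x s, 0 ≤ c x s) {k x s : ℕ} :
    gtc c k x s = true ↔ (1/2 : ℚ)^k < c x s := by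
  unfold gtc
  rw [ltb_iff, frac_lt_iff (h0 x s)]

theorem c_gtc {c : ℕ → ℕ → ℚ} (hc : Computable fun p : ℕ × ℕ => c p.1 p.2) :
    Computable fun p : ℕ × ℕ × ℕ => gtc c p.1 p.2.1 p.2.2 := by
  unfold gtc
  fun_prop

theorem disjoint_count (H : Finset ℕ) (u : ℕ → ℕ) (D : ℕ → ℕ → Bool) (M : ℕ)
    (hbig : ∀ i ∈ H, 2 ^ (u i) < (∑ v ∈ Finset.range (2 ^ u i), (D i v).toNat) * 2 ^ M)
    (hdis : ∀ i ∈ H, ∀ j ∈ H, i < j → u i ≤ u j ∧ ∀ v, D i (v / 2 ^ (u j - u i)) = true → ¬ D j v = true) :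
    H.card ≤ 2 ^ M := by
  set T := H.sup u with hT
  have hle : ∀ i ∈ H, u i ≤ T := fun i hi => Finset.le_sup hi
  have h1 : ∑ i ∈ H, ∑ v ∈ Finset.range (2 ^ T), (D i (v / 2 ^ (T - u i))).toNat ≤ 2 ^ T := by
    rw [Finset.sum_comm]
    have : ∀ v ∈ Finset.range (2 ^ T), ∑ i ∈ H, (D i (v / 2 ^ (T - u i))).toNat ≤ 1 := by
      intro v _
      have h2 : ∑ i ∈ H, (D i (v / 2 ^ (T - u i))).toNat =
          (H.filter (fun i => D i (v / 2 ^ (T - u i)) = true)).card := by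
        rw [Finset.card_filter]
        refine Finset.sum_congr rfl (fun i _ => ?_)
        cases D i (v / 2 ^ (T - u i)) <;> simp
      rw [h2, Finset.card_le_one]
      have key : ∀ i ∈ H, ∀ j ∈ H, D i (v / 2 ^ (T - u i)) = true → D j (v / 2 ^ (T - u j)) = true → ¬ i < j := by
        intro i hi j hj h3 h4 hij
        obtain ⟨h5, h6⟩ := hdis i hi j hj hij
        refine h6 (v / 2 ^ (T - u j)) ?_ h4
        rw [div_div_pow v (hle j hj) h5]
        exact h3
      intro i hi j hj
      rw [Finset.mem_filter] at hi hj
      have := key i hi.1 j hj.1 hi.2 hj.2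
      have := key j hj.1 i hi.1 hj.2 hi.2
      omega
    refine le_trans (Finset.sum_le_sum this) ?_
    simp
  have h2 : ∀ i ∈ H, 2 ^ T ≤ (∑ v ∈ Finset.range (2 ^ T), (D i (v / 2 ^ (T - u i))).toNat) * 2 ^ M := by
    intro i hi
    rw [sum_lift' (fun v => (D i v).toNat) (hle i hi), mul_assoc]
    calc 2 ^ T = 2 ^ (T - u i) * 2 ^ u i := by
          rw [← pow_add]; congr 1; have := hle i hi; omega
      _ ≤ _ := Nat.mul_le_mul_left _ (hbig i hi).le
  have h3 := Finset.sum_le_sum h2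
  rw [← Finset.sum_mul, Finset.sum_const, smul_eq_mul] at h3
  have h4 := le_trans h3 (Nat.mul_le_mul_right _ h1)
  rw [mul_comm (2 ^ T)] at h4
  exact Nat.le_of_mul_le_mul_right h4 (by positivity)

theorem geom_bound (K : ℕ) : ∑ k ∈ Finset.range K, (16 : ℚ) * (1/2)^k ≤ 32 := by
  have : ∑ k ∈ Finset.range K, (16 : ℚ) * (1/2)^k = 32 - 32 * (1/2)^K := by
    induction K with
    | zero => simp
    | succ K ih =>
      rw [Finset.sum_range_succ, ih, pow_succ]
      ring
  rw [this]
  have : (0:ℚ) ≤ (1/2)^K := by positivity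
  linarith

theorem obey_of {c : ℕ → ℕ → ℚ} (hc : CostFunction c) {A : ℕ → Bool} {As : ℕ → ℕ → Bool}
    (cA : Computable fun p : ℕ × ℕ => As p.1 p.2) (mA : ∀ s x, As s x = true → As (s+1) x = true)
    (lA : ∀ x, ∃ t, ∀ s, t ≤ s → As s x = A x)
    (n C : ℕ → ℕ → ℕ) (D : ℕ → ℕ → ℕ → Bool) (θ Mf : ℕ → ℕ)
    (cn : Computable fun p : ℕ × ℕ => n p.1 p.2) (cC : Computable fun p : ℕ × ℕ => C p.1 p.2)
    (cθ : Computable θ) (cM : Computable Mf)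
    (hC : ∀ k s, C k s = ∑ v ∈ Finset.range (2 ^ s), (D k s v).toNat)
    (hD : ∀ k s t v x, s ≤ t → x < n k s → As s x = false → As t x = true → 
      D k s (v / 2 ^ (t - s)) = true → ¬ D k t v = true)
    (F1 : ∀ k, ∃ N s0, k ≤ N ∧ (∀ s, s0 ≤ s → n k s = N) ∧ ∀ x s, N ≤ x → c x s ≤ (1/2)^θ k)
    (F2 : ∀ k, ∃ s0, ∀ s, s0 ≤ s → 2 ^ s < C k s * 2 ^ Mf k)
    (hθ : ∀ k, θ k + 4 = Mf (k+1) + k) : Obeys A c := by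
  obtain ⟨cc, c0, c1, c2⟩ := hc
  choose N s0 hN1 hN2 hN3 using F1
  choose s1 hs1 using F2
  choose t0 ht0 using lA
  set N0 := N 0 with hN0
  set S0 := (Finset.range N0).sup t0 with hS0
  have hS0' : ∀ x < N0, t0 x ≤ S0 := fun x hx => Finset.le_sup (Finset.mem_range.2 hx)
  have hk : ∀ x, ∃ k, x < N0 ∨ (N k ≤ x ∧ x < N (k+1)) := by
    intro x
    by_cases hx : x < N0
    · exact ⟨0, Or.inl hx⟩
    · have hex : ∃ k, x < N k := ⟨x+1, hN1 (x+1)⟩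
      have h1 := Nat.find_spec hex
      have h2 : Nat.find hex ≠ 0 := by
        intro h; rw [h] at h1; exact hx h1
      obtain ⟨j, hj⟩ := Nat.exists_eq_succ_of_ne_zero h2
      have h3 := Nat.find_min hex (m := j) (by omega)
      refine ⟨j, Or.inr ⟨by omega, ?_⟩⟩
      rw [hj] at h1
      exact h1
  choose kx hkx using hk
  -- the test for good stages
  obtain ⟨G, hG⟩ : ∃ G : ℕ → ℕ → ℕ → Bool, ∀ k x s, G k x s = gtc c k x s := ⟨gtc c, fun _ _ _ => rfl⟩
  have cG : Computable fun p : ℕ × ℕ × ℕ => G p.1 p.2.1 p.2.2 := by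
    simp only [hG]
    exact c_gtc cc
  obtain ⟨I, hI⟩ : ∃ I : ℕ → ℕ → ℕ → Bool, ∀ x s k, I x s k = (ltb x (n (k+1) s) && (ltb (2^s) (C (k+1) s * 2^(Mf (k+1))) && !(G (θ k) x s))) := ⟨fun x s k => (ltb x (n (k+1) s) && (ltb (2^s) (C (k+1) s * 2^(Mf (k+1))) && !(G (θ k) x s))), fun _ _ _ => rfl⟩
  have cI : Computable fun p : ℕ × ℕ × ℕ => I p.1 p.2.1 p.2.2 := by
    simp only [hI]
    fun_prop
  obtain ⟨Q, hQ⟩ : ∃ Q : ℕ → ℕ → Bool, ∀ i s, Q i s = (leb (i+1) s && (leb S0 s && ball (i+1) (fun x => ltb x N0 || bex (s+1) (fun k => I x s k)))) := ⟨fun i s => (leb (i+1) s && (leb S0 s && ball (i+1) (fun x => ltb x N0 || bex (s+1) (fun k => I x s k)))), fun _ _ => rfl⟩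
  have cQ : Computable fun p : ℕ × ℕ => Q p.1 p.2 := by
    simp only [hQ]
    fun_prop
  have hQ' : ∀ i s, Q i s = true → i + 1 ≤ s ∧ S0 ≤ s ∧ ∀ x ≤ i, N0 ≤ x → ∃ k, x < n (k+1) s ∧ 
      2^s < C (k+1) s * 2^(Mf (k+1)) ∧ c x s ≤ (1/2)^θ k := by
    intro i s h
    simp only [hQ, hI, hG, Bool.and_eq_true, leb_iff, ball_iff, Bool.or_eq_true, ltb_iff, bex_iff, Bool.not_eq_true'] at h
    refine ⟨h.1, h.2.1, fun x hx hx0 => ?_⟩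
    rcases h.2.2 x (by omega) with h1 | ⟨k, _, h1, h2, h3⟩
    · omega
    · refine ⟨k, h1, h2, ?_⟩
      rw [← Bool.not_eq_true, gtc_iff c0] at h3
      exact not_lt.1 h3
  have hex : ∀ q : ℕ × ℕ, ∃ s, (ltb q.2 s && Q q.1 s) = true := by
    rintro ⟨i, a⟩
    set B := (Finset.range (i+1)).sup (fun x => max (kx x) (max (s0 (kx x + 1)) (s1 (kx x + 1)))) with hB
    have hB' : ∀ x < i+1, max (kx x) (max (s0 (kx x + 1)) (s1 (kx x + 1))) ≤ B := fun x hx =>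
      Finset.le_sup (f := fun x => max (kx x) (max (s0 (kx x + 1)) (s1 (kx x + 1)))) (Finset.mem_range.2 hx)
    refine ⟨max (max (a+1) (i+1)) (max S0 B), ?_⟩
    set s := max (max (a+1) (i+1)) (max S0 B) with hs
    simp only [hQ, hI, hG, Bool.and_eq_true, leb_iff, ball_iff, Bool.or_eq_true, ltb_iff, bex_iff, Bool.not_eq_true']
    refine ⟨by omega, by omega, by omega, fun x hx => ?_⟩
    rcases hkx x with h | ⟨h1, h2⟩
    · exact Or.inl h
    · right
      have h3 := hB' x hx
      refine ⟨kx x, by omega, ?_, hs1 _ _ (by omega), ?_⟩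
      · rw [hN2 _ s (by omega)]
        exact h2
      · rw [← Bool.not_eq_true, gtc_iff c0]
        exact not_lt.2 (hN3 _ _ _ h1)
  obtain ⟨nx, hnx⟩ : ∃ nx : ℕ → ℕ → ℕ, ∀ i a, nx i a = Nat.find (hex (i, a)) := ⟨fun i a => Nat.find (hex (i, a)), fun _ _ => rfl⟩
  have cnx : Computable fun p : ℕ × ℕ => nx p.1 p.2 := by
    simp only [hnx]
    exact c_find (p := fun (q : ℕ × ℕ) s => (ltb q.2 s && Q q.1 s)) (by fun_prop) hex
  have snx : ∀ i a, a < nx i a ∧ Q i (nx i a) = true := by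
    intro i a
    have := Nat.find_spec (hex (i, a))
    rw [← hnx, Bool.and_eq_true, ltb_iff] at this
    exact this
  obtain ⟨st, hst⟩ : ∃ st : ℕ → ℕ, ∀ i, st i = Nat.rec (motive := fun _ => ℕ) (nx 0 0) (fun i r => nx (i+1) r) i := ⟨_, fun _ => rfl⟩
  have cst : Computable st := by
    have : Computable fun i : ℕ => (Nat.rec (motive := fun _ => ℕ) (nx 0 0) (fun i r => nx (i+1) r) i : ℕ) := by
      fun_prop
    exact this.of_eq (fun i => (hst i).symm)
  have sst : ∀ i, Q i (st i) = true := by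
    intro i
    rw [hst]
    cases i with
    | zero => exact (snx _ _).2
    | succ i => exact (snx _ _).2
  have mst : ∀ i, st i < st (i+1) := by
    intro i
    rw [hst, hst]
    exact (snx _ _).1
  have mst' : StrictMono st := strictMono_nat_of_lt_succ mst
  clear_value N0 S0
  set As' : ℕ → ℕ → Bool := fun i x => As (st (max i x)) x with hAs'
  refine ⟨As', ⟨?_, ?_⟩, 32, ?_⟩
  · have : Computable fun p : ℕ × ℕ => As (st (max p.1 p.2)) p.2 := by fun_prop
    exact this
  · intro x
    refine ⟨t0 x, fun s hs => ht0 x _ ?_⟩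
    have := (hQ' _ _ (sst (max s x))).1
    omega
  -- the cost of a change
  have hch : ∀ s, stageCost c As' s ≠ 0 → ∃ k x, 1 ≤ s ∧ x < n (k+1) (st (s-1)) ∧ 
      2^(st (s-1)) < C (k+1) (st (s-1)) * 2^(Mf (k+1)) ∧ As (st (s-1)) x = false ∧ As (st s) x = true ∧
      stageCost c As' s ≤ (1/2)^θ k := by
    intro s hs
    unfold stageCost at *
    by_cases hs0 : s = 0
    · rw [if_pos hs0] at hs
      exact absurd rfl hs
    rw [if_neg hs0] at *
    by_cases h : ∃ x, As' s x ≠ As' (s-1) x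
    · rw [dif_pos h] at *
      have h1 := Nat.find_spec h
      set x := Nat.find h with hx
      clear_value x
      have hxs : x ≤ s - 1 := by
        by_contra hcon
        apply h1
        show As (st (max s x)) x = As (st (max (s-1) x)) x
        rw [show max s x = x by omega, show max (s-1) x = x by omega]
      have h2 : As' s x = As (st s) x := by
        show As (st (max s x)) x = _
        rw [show max s x = s by omega]
      have h3 : As' (s-1) x = As (st (s-1)) x := by
        show As (st (max (s-1) x)) x = _
        rw [show max (s-1) x = s-1 by omega]
      rw [h2, h3] at h1
      obtain ⟨q1, q2, q3⟩ := hQ' _ _ (sst (s-1))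
      obtain ⟨q4, q5, _⟩ := hQ' _ _ (sst s)
      have hxN : N0 ≤ x := by
        by_contra hcon
        have := hS0' x (by omega)
        apply h1
        rw [ht0 x _ (by omega), ht0 x _ (by omega)]
      obtain ⟨k, a1, a2, a3⟩ := q3 x hxs hxN
      have hf : As (st (s-1)) x = false := by
        by_contra hcon
        rw [Bool.not_eq_false] at hcon
        apply h1
        rw [hcon]
        exact A_mono As mA (mst'.monotone (by omega)) hcon
      refine ⟨k, x, by omega, a1, a2, hf, ?_, le_trans (c1 _ _ _ (by omega)) a3⟩
      rw [hf] at h1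
      simpa using h1
    · rw [dif_neg h] at hs
      exact absurd rfl hs
  intro F
  classical
  have hch' : ∀ s, ∃ k, stageCost c As' s ≠ 0 → ∃ x, 1 ≤ s ∧ x < n (k+1) (st (s-1)) ∧ 
      2^(st (s-1)) < C (k+1) (st (s-1)) * 2^(Mf (k+1)) ∧ As (st (s-1)) x = false ∧ As (st s) x = true ∧
      stageCost c As' s ≤ (1/2)^θ k := by
    intro s
    by_cases hs : stageCost c As' s ≠ 0
    · obtain ⟨k, hk⟩ := hch s hs
      exact ⟨k, fun _ => hk⟩
    · exact ⟨0, fun h => absurd h hs⟩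
  choose κ hκ using hch'
  set H := F.filter (fun s => stageCost c As' s ≠ 0) with hH
  have hHm : ∀ s ∈ H, stageCost c As' s ≠ 0 := fun s hs => (Finset.mem_filter.1 hs).2
  have e1 : ∑ s ∈ F, stageCost c As' s = ∑ s ∈ H, stageCost c As' s := (Finset.sum_filter_ne_zero F).symm
  rw [e1]
  set K := H.sup κ + 1 with hK
  have hKm : ∀ s ∈ H, κ s ∈ Finset.range K := fun s hs => by
    have := Finset.le_sup (f := κ) hs
    rw [Finset.mem_range]
    omega
  rw [← Finset.sum_fiberwise_of_maps_to hKm]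
  refine le_trans (Finset.sum_le_sum (fun k _ => ?_)) (geom_bound K)
  set Hk := H.filter (fun s => κ s = k) with hHk
  have hHkm : ∀ s ∈ Hk, κ s = k ∧ stageCost c As' s ≠ 0 := fun s hs =>
    ⟨(Finset.mem_filter.1 hs).2, hHm s (Finset.mem_filter.1 hs).1⟩
  have hcard : Hk.card ≤ 2 ^ Mf (k+1) := by
    refine disjoint_count Hk (fun s => st (s-1)) (fun s => D (k+1) (st (s-1))) (Mf (k+1)) ?_ ?_
    · intro s hs
      obtain ⟨h1, h2⟩ := hHkm s hs
      obtain ⟨x, _, _, h3, _⟩ := hκ s h2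
      rw [h1, hC] at h3
      exact h3
    · intro i hi j hj hij
      obtain ⟨h1, h2⟩ := hHkm i hi
      obtain ⟨x, hi1, h3, h4, h5, h6, h7⟩ := hκ i h2
      have hle : st (i-1) ≤ st (j-1) := mst'.monotone (by omega)
      refine ⟨hle, fun v => hD (k+1) _ _ v x hle (by rw [← h1]; exact h3) h5 ?_⟩
      exact A_mono As mA (mst'.monotone (by omega)) h6
  calc ∑ s ∈ Hk, stageCost c As' s ≤ ∑ s ∈ Hk, (1/2 : ℚ)^θ k := by
        refine Finset.sum_le_sum (fun s hs => ?_)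
        obtain ⟨h1, h2⟩ := hHkm s hs
        obtain ⟨x, _, _, _, _, _, h3⟩ := hκ s h2
        rw [h1] at h3
        exact h3
    _ = (Hk.card : ℚ) * (1/2)^θ k := by rw [Finset.sum_const, nsmul_eq_mul]
    _ ≤ ((2 ^ Mf (k+1) : ℕ) : ℚ) * (1/2)^θ k := by
        refine mul_le_mul_of_nonneg_right ?_ (by positivity)
        exact_mod_cast hcard
    _ = 16 * (1/2)^k := by
        have h1 : (2:ℚ) ^ Mf (k+1) * 2 ^ k = 2 ^ θ k * 16 := by
          rw [← pow_add, ← hθ, pow_add]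
          norm_num
        push_cast
        rw [one_div, inv_pow, inv_pow]
        field_simp
        linarith

end Obey


/-! ## From computation below ω-c.a. randoms to obedience -/

section Backward

/-- the cost threshold of requirement `m` -/
def theta (m : ℕ) : ℕ := Nat.pair m.unpair.1 (m.unpair.2 + 1) + m.unpair.2

/-- the length of agreement requested by requirement `m` at stage `s` -/
def nn (c : ℕ → ℕ → ℚ) (m s : ℕ) : ℕ := Nat.rec (motive := fun _ => ℕ) m
  (fun s r => bif leb r s && gtc c (theta m) r (s+1) then s+1 else r) s

theorem nn_succ (c : ℕ → ℕ → ℚ) (m s : ℕ) : nn c m (s+1) =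
    bif leb (nn c m s) s && gtc c (theta m) (nn c m s) (s+1) then s+1 else nn c m s := rfl

/-- predictions of functional `e` -/
def PP (e b s v x : ℕ) : Bool :=
  bex (s+1) fun l => evB e s (Nat.pair (Nat.pair l (v / 2 ^ (s - l))) x) b

theorem PP_mono (e b s v x : ℕ) (h : PP e b s (v/2) x = true) : PP e b (s+1) v x = true := by
  unfold PP at *
  rw [bex_iff] at *
  obtain ⟨l, h1, h2⟩ := h
  refine ⟨l, by omega, evB_mono (Nat.le_succ s) ?_⟩
  rw [← div_succ_pow v (by omega)]
  exact h2

variable {c : ℕ → ℕ → ℚ}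

theorem nn_mono (m s : ℕ) : nn c m s ≤ nn c m (s+1) := by
  rw [nn_succ]
  cases h : leb (nn c m s) s && gtc c (theta m) (nn c m s) (s+1) with
  | false => exact le_refl _
  | true =>
    rw [Bool.and_eq_true, leb_iff] at h
    simp only [cond_true]
    omega

theorem nn_ge (m s : ℕ) : m ≤ nn c m s := by
  induction s with
  | zero => exact le_refl _
  | succ s ih => exact le_trans ih (nn_mono m s)

theorem c_nn (hc : Computable fun p : ℕ × ℕ => c p.1 p.2) : Computable fun p : ℕ × ℕ => nn c p.1 p.2 := by
  have h1 := c_gtc hc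
  unfold nn theta
  generalize gtc c = G at *
  fun_prop

theorem c_PP : Computable fun p : ℕ × ℕ × ℕ × ℕ × ℕ => PP p.1.unpair.1 p.2.1 p.2.2.1 p.2.2.2.1 p.2.2.2.2 := by
  have := c_evB
  unfold PP
  generalize evB = E at *
  fun_prop

open Classical in
theorem nn_changes (h0 : ∀ x s, 0 ≤ c x s) (b : ℕ → ℕ)
    (hb : ∀ k m (x s : ℕ → ℕ), (∀ i < m, x i < s i) → (∀ i, i + 1 < m → s i ≤ x (i+1)) →
      (∀ i < m, ((1:ℚ)/2)^k ≤ c (x i) (s i)) → m ≤ b k) (m S : ℕ) :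
    ((Finset.range S).filter (fun s => nn c m (s+1) ≠ nn c m s)).card ≤ b (theta m) := by
  have key : ∃ x s : ℕ → ℕ, ∀ N, N = ((Finset.range S).filter (fun s => nn c m (s+1) ≠ nn c m s)).card →
      (∀ i < N, x i < s i) ∧ (∀ i, i + 1 < N → s i ≤ x (i+1)) ∧ 
      (∀ i < N, ((1:ℚ)/2)^(theta m) ≤ c (x i) (s i)) ∧ (∀ i < N, s i ≤ nn c m S) := by
    induction S with
    | zero => exact ⟨fun _ => 0, fun _ => 0, by simp⟩
    | succ S ih =>
      obtain ⟨x, s, h⟩ := ih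
      obtain ⟨h1, h2, h3, h4⟩ := h _ rfl
      rw [count_succ]
      set N := ((Finset.range S).filter (fun s => nn c m (s+1) ≠ nn c m s)).card with hN
      by_cases hch : nn c m (S+1) ≠ nn c m S
      · rw [if_pos hch]
        have hcond : (leb (nn c m S) S && gtc c (theta m) (nn c m S) (S+1)) = true := by
          by_contra hcon
          rw [Bool.not_eq_true] at hcon
          apply hch
          rw [nn_succ, hcon, cond_false]
        have hval : nn c m (S+1) = S+1 := by rw [nn_succ, hcond, cond_true]
        rw [Bool.and_eq_true, leb_iff, gtc_iff h0] at hcond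
        refine ⟨fun i => if i < N then x i else nn c m S, fun i => if i < N then s i else S+1, ?_⟩
        rintro _ rfl
        refine ⟨fun i hi => ?_, fun i hi => ?_, fun i hi => ?_, fun i hi => ?_⟩
        · by_cases hiN : i < N
          · simp only [hiN, if_true]; exact h1 i hiN
          · simp only [hiN, if_false]; omega
        · have hiN : i < N := by omega
          simp only [hiN, if_true]
          by_cases hiN' : i + 1 < N
          · simp only [hiN', if_true]; exact h2 i hiN'
          · simp only [hiN', if_false]; exact h4 i hiN
        · by_cases hiN : i < N
          · simp only [hiN, if_true]; exact h3 i hiN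
          · simp only [hiN, if_false]; exact hcond.2.le
        · rw [hval]
          by_cases hiN : i < N
          · simp only [hiN, if_true]
            have := h4 i hiN
            omega
          · simp only [hiN, if_false]; omega
      · rw [if_neg hch]
        refine ⟨x, s, ?_⟩
        rintro _ rfl
        refine ⟨h1, h2, h3, fun i hi => ?_⟩
        push Not at hch
        rw [hch]
        exact h4 i hi
  obtain ⟨x, s, h⟩ := key
  obtain ⟨h1, h2, h3, _⟩ := h _ rfl
  exact hb _ _ x s h1 h2 h3

set_option maxHeartbeats 1000000 in
theorem backward (A : ℕ → Bool) (hce : CE A)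
    (h : ∀ Z, MLRandom Z → OmegaCA Z → TuringLE A Z) (hc : CostFunction c) (hben : Benign c) :
    Obeys A c := by
  classical
  obtain ⟨cc, c0, c1, c2⟩ := hc
  obtain ⟨b, cb, hb⟩ := hben
  obtain ⟨f, hf, hA⟩ := hce
  obtain ⟨ea, hea⟩ := evB_complete hf
  obtain ⟨As, hAs⟩ : ∃ As : ℕ → ℕ → Bool, ∀ s x, As s x = ltb 0 (evo ea s x) := ⟨fun s x => ltb 0 (evo ea s x), fun _ _ => rfl⟩
  have cA : Computable fun p : ℕ × ℕ => As p.1 p.2 := by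
    have := c_evo
    simp only [hAs]
    generalize evo = E at *
    fun_prop
  have hAs' : ∀ s x, As s x = true ↔ ∃ y, evB ea s x y = true := by
    intro s x
    rw [hAs, ltb_iff]
    constructor
    · intro h
      refine ⟨evo ea s x - 1, ?_⟩
      rw [← evo_iff]
      omega
    · rintro ⟨y, hy⟩
      rw [← evo_iff] at hy
      omega
  have mA : ∀ s x, As s x = true → As (s+1) x = true := by
    intro s x h
    rw [hAs'] at *
    obtain ⟨y, hy⟩ := h
    exact ⟨y, evB_mono (Nat.le_succ s) hy⟩
  have lA : ∀ x, ∃ t, ∀ s, t ≤ s → As s x = A x := by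
    intro x
    have hx : A x = true ↔ ∃ s, As s x = true := by
      rw [hA, Part.dom_iff_mem]
      constructor
      · rintro ⟨y, hy⟩
        obtain ⟨s, hs⟩ := (hea x y).1 hy
        exact ⟨s, (hAs' s x).2 ⟨y, hs⟩⟩
      · rintro ⟨s, hs⟩
        obtain ⟨y, hy⟩ := (hAs' s x).1 hs
        exact ⟨y, (hea x y).2 ⟨s, hy⟩⟩
    by_cases hAx : A x = true
    · obtain ⟨t, ht⟩ := hx.1 hAx
      exact ⟨t, fun s hs => by rw [hAx]; exact A_mono As mA hs ht⟩
    · refine ⟨0, fun s _ => ?_⟩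
      rw [Bool.not_eq_true] at hAx
      rw [hAx, ← Bool.not_eq_true]
      intro hs
      have := hx.2 ⟨s, hs⟩
      rw [hAx] at this
      exact absurd this (by simp)
  obtain ⟨P, hP⟩ : ∃ P : ℕ → ℕ → ℕ → ℕ → ℕ → Bool, ∀ m b s v x, P m b s v x = PP m.unpair.1 b s v x :=
    ⟨fun m b s v x => PP m.unpair.1 b s v x, fun _ _ _ _ _ => rfl⟩
  have cP : Computable fun p : ℕ × ℕ × ℕ × ℕ × ℕ => P p.1 p.2.1 p.2.2.1 p.2.2.2.1 p.2.2.2.2 := by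
    simp only [hP]
    exact c_PP
  have mP : ∀ m b s v x, P m b s (v/2) x = true → P m b (s+1) v x = true := by
    intro m b s v x
    rw [hP, hP]
    exact PP_mono _ _ _ _ _
  have cn := c_nn (c := c) cc
  obtain ⟨cC, cW⟩ := c_G cA cn cP
  set W : ℕ → ℕ → ℕ → ℕ := fun m s v => WR m s v + WG As (nn c m) (P m) m s v with hW
  have hcW : Computable fun p : ℕ × ℕ × ℕ => W p.1 p.2.1 p.2.2 := c_add c_WR cW
  have cθ : Computable theta := by
    unfold theta
    fun_prop
  have hnc := nn_changes c0 b hb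
  have hsmall : ∀ m s, (∑ v ∈ Finset.range (2 ^ s), W m s v) * 2 ^ (m+2) ≤ 2 ^ s * 2 ^ (2*m+3) := by
    intro m s
    have h1 := WR_small m s
    have h2 := WG_small As (nn c m) (P m) m s
    simp only [hW]
    rw [Finset.sum_add_distrib]
    have h3 : (2:ℕ) ^ (m+3) = 2 * 2 ^ (m+2) := by ring
    rw [h3] at h1 h2
    nlinarith
  have hres : ∀ m S, ((Finset.range S).filter (Resets W m)).card ≤ (fun m => 1 + (2 * (b (theta m) + 2 ^ (m+4)) + 1)) m := by
    intro m S
    have h1 := WR_resets m S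
    have h2 := WG_resets As (nn c m) (P m) m mA (nn_mono m) (mP m) S
    have h3 : ((Finset.range S).filter (Resets W m)).card ≤ 
        ((Finset.range S).filter (Resets WR m)).card + ((Finset.range S).filter (RG As (nn c m) (P m) m)).card := by
      refine le_trans (Finset.card_le_card ?_) (Finset.card_union_le _ _)
      intro s hs
      rw [Finset.mem_filter] at hs
      rw [Finset.mem_union, Finset.mem_filter, Finset.mem_filter]
      by_contra hcon
      have ha : ¬ Resets WR m s := fun h => hcon (Or.inl ⟨hs.1, h⟩)
      have hb : ¬ RG As (nn c m) (P m) m s := fun h => hcon (Or.inr ⟨hs.1, h⟩)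
      unfold Resets at ha
      unfold RG at hb
      rw [not_not] at ha hb
      exact hs.2 (fun v hv => Nat.add_le_add (ha v hv) (hb v hv))
    have h4 := hnc m S
    show _ ≤ 1 + (2 * (b (theta m) + 2 ^ (m+4)) + 1)
    refine le_trans h3 (Nat.add_le_add h1 (le_trans h2 ?_))
    omega
  obtain ⟨Z, hω, hZ⟩ := avoid hcW (fun m => 1 + (2 * (b (theta m) + 2 ^ (m+4)) + 1)) (by fun_prop) hsmall hres
  have hml : MLRandom Z := random_of_avoid Z W (fun m s v => Nat.le_add_right _ _) hZ
  obtain ⟨e, he⟩ := turing_index (h Z hml hω)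
  have hKst : ∀ m, ∃ s0, ∀ s, s0 ≤ s → ¬ KK As (nn c m) (P m) m s := by
    intro m
    refine stable_of_count _ (b (theta m) + 2 ^ (m+4)) (fun S => ?_)
    exact le_trans (KK_count As (nn c m) (P m) m mA (nn_mono m) (mP m) S) (Nat.add_le_add_right (hnc m S) _)
  refine obey_of ⟨cc, c0, c1, c2⟩ cA mA lA (fun k => nn c (Nat.pair e k)) 
    (fun k => nC As (nn c (Nat.pair e k)) (P (Nat.pair e k)))
    (fun k => Cv As (nn c (Nat.pair e k)) (P (Nat.pair e k)))
    (fun k => theta (Nat.pair e k)) (fun k => Nat.pair e k + 4) ?_ ?_ ?_ (by fun_prop) 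
    (fun _ _ => rfl) ?_ ?_ ?_ ?_
  · generalize nn c = G at cn ⊢
    have : Computable fun p : ℕ × ℕ => G (Nat.pair e p.1) p.2 := by fun_prop
    exact this
  · obtain ⟨G, hG⟩ : ∃ G : ℕ → ℕ → ℕ, ∀ m s, G m s = nC As (nn c m) (P m) s :=
      ⟨fun m s => nC As (nn c m) (P m) s, fun _ _ => rfl⟩
    simp only [← hG] at cC ⊢
    have : Computable fun p : ℕ × ℕ => G (Nat.pair e p.1) p.2 := by fun_prop
    exact this
  · have : Computable fun k => Nat.pair e k := by fun_prop
    exact cθ.comp this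
  · intro k s t v x hst hx h1 h2 h3
    have hm : Monotone (nn c (Nat.pair e k)) := monotone_nat_of_le_succ (nn_mono _)
    exact Cv_disjoint As (nn c (Nat.pair e k)) (P (Nat.pair e k)) mA (mP _) hst hx (hm hst) h1 h2 h3
  · intro k
    obtain ⟨s0, hs0⟩ := hKst (Nat.pair e k)
    have hst : ∀ s, s0 ≤ s → nn c (Nat.pair e k) s = nn c (Nat.pair e k) s0 := by
      intro s hs
      induction s, hs using Nat.le_induction with
      | base => rfl
      | succ s hs ih =>
        have := hs0 s hs
        unfold KK at this
        push Not at this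
        rw [this.1, ih]
    refine ⟨nn c (Nat.pair e k) s0, s0, le_trans (Nat.right_le_pair e k) (nn_ge _ _), hst, ?_⟩
    intro x s hx
    refine le_trans (c2 _ _ _ hx) ?_
    set N := nn c (Nat.pair e k) s0 with hN
    set r := max s (max s0 N) with hr
    refine le_trans (c1 N s (r+1) (by omega)) ?_
    by_contra hcon
    have h1 := hst r (by omega)
    have h2 := hst (r+1) (by omega)
    rw [nn_succ, h1] at h2
    rw [not_le, ← gtc_iff c0] at hcon
    rw [hcon, leb_iff.2 (show N ≤ r by omega)] at h2
    simp only [Bool.and_self, cond_true] at h2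
    omega
  · intro k
    obtain ⟨s0, hs0⟩ := hKst (Nat.pair e k)
    refine density As (nn c (Nat.pair e k)) (P (Nat.pair e k)) (Nat.pair e k) mA (nn_mono _) (mP _) A Z lA ?_ s0 hs0 ?_
    · intro x bb
      rw [he]
      refine exists_congr (fun s => ?_)
      rw [hP, Nat.unpair_pair]
      unfold PP
      rw [bex_iff]
      constructor
      · rintro ⟨l, h1, h2⟩
        refine ⟨l, by omega, ?_⟩
        rw [pre_div' Z h1]
        exact h2
      · rintro ⟨l, h1, h2⟩
        refine ⟨l, by omega, ?_⟩
        rw [pre_div' Z (by omega)] at h2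
        exact h2
    · intro l
      obtain ⟨r, hr⟩ := hZ (Nat.pair e k) l
      refine ⟨r, fun s h1 h2 => ?_⟩
      obtain ⟨v, hv, h3, h4⟩ := hr s h1 h2
      exact ⟨v, hv, h3, lt_of_le_of_lt (Nat.le_add_left _ _) h4⟩
  · intro k
    simp only [theta, Nat.unpair_pair]
    omega

end Backward

/-- A c.e. set obeys every benign cost function iff it is Turing below
every ML-random ω-c.a. set. -/
theorem benign_obedience_iff_below_omega_ca_randoms (A : ℕ → Bool) (hce : CE A) :
    (∀ c : ℕ → ℕ → ℚ, CostFunction c → Benign c → Obeys A c) ↔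
      (∀ Z : ℕ → Bool, MLRandom Z → OmegaCA Z → TuringLE A Z) := by
  exact ⟨fun h Z h1 h2 => forward A h Z h1 h2, fun h c hc hb => backward A hce h hc hb⟩
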